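/- arXiv:1701.01483 — 2 statements merged into one kernel-verified Lean document; each statement's English description precedes it below -/
import Mathlib

section
/- Let p, q: ℝⁿ → ℝ be polynomials of degree at most d with E_{γ_n}[q] = 0. Then E_{γ_n}[(p·q)²] ≤ 9^d · E_{γ_n}[p²] · E_{γ_n}[q²]. -/
open MeasureTheory ProbabilityTheory MvPolynomial
open scoped Classical

noncomputable section

namespace GaussNS

/-- The standard Gaussian measure `γ` on `ι → ℝ`. -/
def gaussianPi (ι : Type*) [Fintype ι] : Measure (ι → ℝ) :=
  Measure.pi fun _ => gaussianReal 0 1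

/-- `Fin k` embedded as the standard basis vectors `e₁, …, e_k` of `ℝᵏ`. -/
def basisVec {k : ℕ} (i : Fin k) : Fin k → ℝ := fun j => if j = i then 1 else 0

/-- The Ornstein–Uhlenbeck operator `P_t` acting on scalar functions:
`(P_t f)(x) = ∫ f(e^{-t} x + √(1-e^{-2t}) y) dγ(y)`. -/
def ouOp {ι : Type*} [Fintype ι] (t : ℝ) (f : (ι → ℝ) → ℝ) (x : ι → ℝ) : ℝ :=
  ∫ y, f (fun i => Real.exp (-t) * x i + Real.sqrt (1 - Real.exp (-2 * t)) * y i) ∂gaussianPi ι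

/-- Noise stability `E⟨f, P_t f⟩` of a `[k]`-valued function on Gaussian space,
where `f` is identified with a basis-vector-valued function. -/
def noiseStab {ι : Type*} [Fintype ι] {k : ℕ} (t : ℝ) (f : (ι → ℝ) → Fin k) : ℝ :=
  ∫ x, ∑ j, basisVec (f x) j * ouOp t (fun y => basisVec (f y) j) x ∂gaussianPi ι

/-- The mean vector `E[f] ∈ Δ_k` of a `[k]`-valued function. -/
def gMean {ι : Type*} [Fintype ι] {k : ℕ} (f : (ι → ℝ) → Fin k) : Fin k → ℝ :=
  fun j => ∫ x, basisVec (f x) j ∂gaussianPi ι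

/-- The multivariate polynomial threshold function `PTF(p₁,…,p_k)`: value `j` if
`p j > 0` and `p i ≤ 0` for all `i ≠ j`, and the first index otherwise. -/
def ptf {ι : Type*} {k : ℕ} [NeZero k] (p : Fin k → MvPolynomial ι ℝ) (x : ι → ℝ) : Fin k :=
  if h : ∃ j, 0 < eval x (p j) ∧ ∀ i, i ≠ j → eval x (p i) ≤ 0 then h.choose else 0

/-- Collision set of a multivariate PTF: points where the number of strictly
positive `p j` is not exactly one. -/
def collisionSet {ι : Type*} {k : ℕ} (p : Fin k → MvPolynomial ι ℝ) : Set (ι → ℝ) :=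
  {x | ¬ ∃! j, 0 < eval x (p j)}

/-- Gaussian expectation of a polynomial. -/
def gExp {ι : Type*} [Fintype ι] (p : MvPolynomial ι ℝ) : ℝ :=
  ∫ x, eval x p ∂gaussianPi ι

/-- Gaussian variance of a polynomial. -/
def gVar {ι : Type*} [Fintype ι] (p : MvPolynomial ι ℝ) : ℝ :=
  (∫ x, (eval x p) ^ 2 ∂gaussianPi ι) - gExp p ^ 2

/-- A family `p₁,…,p_k` of polynomials is `(d, δ)`-balanced if each `p i` has Gaussian
variance `1` and `|E[p i]| ≤ (log (k d / δ))^{d/2}`. -/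
def balancedFam {ι : Type*} [Fintype ι] {k : ℕ} (d : ℕ) (δ : ℝ)
    (p : Fin k → MvPolynomial ι ℝ) : Prop :=
  ∀ i, gVar (p i) = 1 ∧ |gExp (p i)| ≤ Real.log ((k : ℝ) * d / δ) ^ ((d : ℝ) / 2)

/-- The normalized multivariate Hermite polynomial `H_S(x) = ∏ i, H_{S i}(x i)/√(S i)!`. -/
def hermiteH {ι : Type*} [Fintype ι] (S : ι → ℕ) (x : ι → ℝ) : ℝ :=
  ∏ i, (Polynomial.aeval (x i) (Polynomial.hermite (S i)) / Real.sqrt (Nat.factorial (S i)))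

/-- The Hermite coefficient `f̂(S) = E[f · H_S]`. -/
def hermCoeff {ι : Type*} [Fintype ι] (f : (ι → ℝ) → ℝ) (S : ι → ℕ) : ℝ :=
  ∫ x, f x * hermiteH S x ∂gaussianPi ι

/-- Hermite weight `W^{>d}[f] = Σ_{|S| > d} ‖f̂(S)‖²` of a vector-valued function. -/
def wAbove {ι : Type*} [Fintype ι] {k : ℕ} (d : ℕ) (f : (ι → ℝ) → Fin k → ℝ) : ℝ :=
  ∑' S : ι → ℕ, if d < ∑ i, S i then ∑ j, hermCoeff (fun x => f x j) S ^ 2 else 0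

/-- Hermite weight `W^{≥d}[f] = Σ_{|S| ≥ d} f̂(S)²` of a scalar function. -/
def wGE {ι : Type*} [Fintype ι] (d : ℕ) (f : (ι → ℝ) → ℝ) : ℝ :=
  ∑' S : ι → ℕ, if d ≤ ∑ i, S i then hermCoeff f S ^ 2 else 0

/-- Squared `L²(γ)` norm `Σ_{|S| = q} f̂(S)²` of the projection of `f` onto
the `q`-th Wiener chaos. -/
def chaosNormSq {ι : Type*} [Fintype ι] (q : ℕ) (f : (ι → ℝ) → ℝ) : ℝ :=
  ∑' S : ι → ℕ, if (∑ i, S i) = q then hermCoeff f S ^ 2 else 0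

/-- Frobenius norm of a tensor. -/
def frobNorm {α ι : Type*} [Fintype α] [Fintype ι] (T : (α → ι) → ℝ) : ℝ :=
  Real.sqrt (∑ t, T t ^ 2)

/-- Contraction product `f ⊗_r g` of an order-`p` and an order-`q` tensor along `r`
indices, presented as a tensor in the remaining `(p-r)` and `(q-r)` indices. -/
def contr {ι : Type*} [Fintype ι] {p q r : ℕ} (hp : r ≤ p) (hq : r ≤ q)
    (f : (Fin p → ι) → ℝ) (g : (Fin q → ι) → ℝ)
    (a : Fin (p - r) → ι) (b : Fin (q - r) → ι) : ℝ :=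
  ∑ z : Fin r → ι,
    f (fun i => Fin.append a z (Fin.cast (Nat.sub_add_cancel hp).symm i)) *
      g (fun i => Fin.append b z (Fin.cast (Nat.sub_add_cancel hq).symm i))

/-- `λ_{S,S̄}(A)`: the largest singular value of the matricization of `A` along the
partition `(S, S̄)` of its index set. -/
def lamPart {ι : Type*} [Fintype ι] {q : ℕ} (A : (Fin q → ι) → ℝ) (S : Finset (Fin q)) : ℝ :=
  ⨆ g : ({i // i ∈ S} → ι) → ℝ, ⨆ h : ({i // i ∉ S} → ι) → ℝ,
    (∑ t : Fin q → ι, A t * g (fun i => t i.1) * h (fun i => t i.1)) /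
      (frobNorm g * frobNorm h)

/-- `λ_max(A)`: maximum of `λ_{S,S̄}(A)` over nontrivial partitions `(S, S̄)`. -/
def lamMax {ι : Type*} [Fintype ι] {q : ℕ} (A : (Fin q → ι) → ℝ) : ℝ :=
  ⨆ S : {S : Finset (Fin q) // S ≠ ∅ ∧ S ≠ Finset.univ}, lamPart A S.1

/-- The symmetric tensor `A_q` with `p = Σ_q I_q(A_q)` for a multilinear polynomial
(in terms of its Hermite coefficients). -/
def chaosTensor {ι : Type*} [Fintype ι] [DecidableEq ι] (f : (ι → ℝ) → ℝ) (q : ℕ) :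
    (Fin q → ι) → ℝ :=
  fun t => if Function.Injective t then
      hermCoeff f (fun i => (Finset.univ.filter fun j => t j = i).card) / Real.sqrt (Nat.factorial q)
    else 0

/-- `λ_max(p) = max_{2 ≤ q ≤ deg p} λ_max(A_q)`. -/
def polyLamMax {ι : Type*} [Fintype ι] [DecidableEq ι] (p : MvPolynomial ι ℝ) : ℝ :=
  ⨆ q : {q : ℕ // 2 ≤ q ∧ q ≤ p.totalDegree}, lamMax (chaosTensor (fun x => eval x p) q.1)

/-- A polynomial is `δ`-eigenregular if `λ_max(p) ≤ δ √(Var p)`. -/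
def eigenregular {ι : Type*} [Fintype ι] [DecidableEq ι] (δ : ℝ) (p : MvPolynomial ι ℝ) : Prop :=
  polyLamMax p ≤ δ * Real.sqrt (gVar p)

/-- `p` lies in the `j`-th Wiener chaos `W^j`. -/
def inChaos {ι : Type*} [Fintype ι] (j : ℕ) (p : MvPolynomial ι ℝ) : Prop :=
  ∀ S : ι → ℕ, (∑ i, S i) ≠ j → hermCoeff (fun x => eval x p) S = 0

/-- Expectation over the uniform measure on the hypercube `{-1,1}ⁿ ≃ Boolⁿ`. -/
def cubeE {n : ℕ} (g : (Fin n → Bool) → ℝ) : ℝ := (∑ x, g x) / 2 ^ n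

/-- The Bonami–Beckner operator `T_ρ` on the hypercube. -/
def bbOp {n : ℕ} (ρ : ℝ) (g : (Fin n → Bool) → ℝ) (x : Fin n → Bool) : ℝ :=
  ∑ y : Fin n → Bool, (∏ i, if y i = x i then (1 + ρ) / 2 else (1 - ρ) / 2) * g y

/-- Noise stability `E⟨f, T_ρ f⟩` on the hypercube of a `[k]`-valued function. -/
def cubeStab {n k : ℕ} (ρ : ℝ) (f : (Fin n → Bool) → Fin k) : ℝ :=
  cubeE fun x => ∑ j, basisVec (f x) j * bbOp ρ (fun y => basisVec (f y) j) x

/-- Influence of coordinate `i`: `Inf_i(f) = E_z[Var(f_{z,-i})]`, computed as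
`E_x[‖f(x) - f(x^{⊕i})‖² / 4]`. -/
def influence {n k : ℕ} (i : Fin n) (f : (Fin n → Bool) → Fin k → ℝ) : ℝ :=
  cubeE fun x => (∑ j, (f x j - f (Function.update x i (!(x i))) j) ^ 2) / 4

/-- `g ∈ T_z(F)`: `g` is a measurable rounding of `F` by thresholding at `z`, i.e.
`⟨e_{g(x)}, F(x) - z⟩ ≥ F_i(x) - z_i` for all `i` and `x`. -/
def memTz {ι : Type*} [Fintype ι] {k : ℕ} (z : Fin k → ℝ) (F : (ι → ℝ) → Fin k → ℝ)
    (g : (ι → ℝ) → Fin k) : Prop :=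
  Measurable (fun x => basisVec (g x)) ∧ ∀ x i, F x i - z i ≤ F x (g x) - z (g x)

/-- `V` bounds the Gaussian total variation `E[|∇f|]` of `f`, characterized
distributionally: for every `C¹` compactly supported vector field `φ` with `‖φ‖ ≤ 1`,
`∫ f · (div φ - ⟨x, φ⟩) dγ ≤ V`.  The least such `V` is `E[|∇f|]`. -/
def gaussTV {n : ℕ} (f : (Fin n → ℝ) → ℝ) (V : ℝ) : Prop :=
  ∀ φ : (Fin n → ℝ) → (Fin n → ℝ), ContDiff ℝ 1 φ → HasCompactSupport φ →
    (∀ x, Real.sqrt (∑ i, φ x i ^ 2) ≤ 1) →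
    (∫ x, f x * ((∑ i, fderiv ℝ (fun y => φ y i) x (Pi.single i 1)) - ∑ i, x i * φ x i)
        ∂gaussianPi (Fin n)) ≤ V

/-- Evaluation of a polynomial at the noisy point `e^{-t} x + √(1-e^{-2t}) y`. -/
def corrEval {m : ℕ} (t : ℝ) (p : MvPolynomial (Fin m) ℝ)
    (xy : (Fin m → ℝ) × (Fin m → ℝ)) : ℝ :=
  eval (fun i => Real.exp (-t) * xy.1 i + Real.sqrt (1 - Real.exp (-2 * t)) * xy.2 i) p

end GaussNS

namespace GaussNS

/-- Measurable functions of at most polynomial growth. -/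
def PolyGrowth {E : Type*} [NormedAddCommGroup E] [MeasurableSpace E] (f : E → ℝ) : Prop :=
  Measurable f ∧ ∃ (C : ℝ) (N : ℕ), 0 ≤ C ∧ ∀ x, |f x| ≤ C * (1 + ‖x‖) ^ N

namespace PolyGrowth

variable {E F : Type*} [NormedAddCommGroup E] [MeasurableSpace E]
  [NormedAddCommGroup F] [MeasurableSpace F]

theorem const (c : ℝ) : PolyGrowth fun _ : E => c :=
  ⟨measurable_const, |c|, 0, abs_nonneg c, by simp⟩

theorem add {f g : E → ℝ} (hf : PolyGrowth f) (hg : PolyGrowth g) :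
    PolyGrowth fun x => f x + g x := by
  obtain ⟨mf, C, N, hC, hf⟩ := hf
  obtain ⟨mg, D, M, hD, hg⟩ := hg
  refine ⟨mf.add mg, C + D, N + M, add_nonneg hC hD, fun x => ?_⟩
  have h1 : 1 ≤ 1 + ‖x‖ := by linarith [norm_nonneg x]
  calc |f x + g x| ≤ |f x| + |g x| := abs_add_le _ _
    _ ≤ C * (1 + ‖x‖) ^ N + D * (1 + ‖x‖) ^ M := add_le_add (hf x) (hg x)
    _ ≤ C * (1 + ‖x‖) ^ (N + M) + D * (1 + ‖x‖) ^ (N + M) := by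
        gcongr <;> first | exact h1 | omega
    _ = _ := by ring

theorem mul {f g : E → ℝ} (hf : PolyGrowth f) (hg : PolyGrowth g) :
    PolyGrowth fun x => f x * g x := by
  obtain ⟨mf, C, N, hC, hf⟩ := hf
  obtain ⟨mg, D, M, hD, hg⟩ := hg
  refine ⟨mf.mul mg, C * D, N + M, mul_nonneg hC hD, fun x => ?_⟩
  calc |f x * g x| = |f x| * |g x| := abs_mul _ _
    _ ≤ (C * (1 + ‖x‖) ^ N) * (D * (1 + ‖x‖) ^ M) :=
        mul_le_mul (hf x) (hg x) (abs_nonneg _) (by positivity)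
    _ = _ := by ring

theorem pow {f : E → ℝ} (hf : PolyGrowth f) (k : ℕ) : PolyGrowth fun x => f x ^ k := by
  induction k with
  | zero => simpa using const (E := E) 1
  | succ k ih => simpa only [pow_succ] using ih.mul hf

theorem comp_clm [NormedSpace ℝ E] [NormedSpace ℝ F] [BorelSpace E] [BorelSpace F]
    [SecondCountableTopology E] {f : F → ℝ} (hf : PolyGrowth f) (L : E →L[ℝ] F) :
    PolyGrowth fun x => f (L x) := by
  obtain ⟨mf, C, N, hC, hf⟩ := hf
  refine ⟨mf.comp L.continuous.measurable, C * (1 + ‖L‖) ^ N, N, by positivity, fun x => ?_⟩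
  calc |f (L x)| ≤ C * (1 + ‖L x‖) ^ N := hf _
    _ ≤ C * ((1 + ‖L‖) * (1 + ‖x‖)) ^ N := by
        gcongr
        nlinarith [L.le_opNorm x, norm_nonneg x, norm_nonneg L]
    _ = _ := by rw [mul_pow]; ring

theorem comp_lincomb [NormedSpace ℝ E] [BorelSpace E] [SecondCountableTopology E] {f : E → ℝ}
    (hf : PolyGrowth f) (α β : ℝ) : PolyGrowth fun z : E × E => f (α • z.1 + β • z.2) :=
  hf.comp_clm (α • ContinuousLinearMap.fst ℝ E E + β • ContinuousLinearMap.snd ℝ E E)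

theorem section_fst {f : E × F → ℝ} (hf : PolyGrowth f) (y : F) : PolyGrowth fun x => f (x, y) := by
  obtain ⟨mf, C, N, hC, hf⟩ := hf
  refine ⟨mf.comp measurable_prodMk_right, C * (1 + ‖y‖) ^ N, N, by positivity, fun x => ?_⟩
  refine (hf _).trans ?_
  rw [mul_assoc, ← mul_pow]
  have : ‖(x, y)‖ ≤ ‖x‖ + ‖y‖ := by
    rw [Prod.norm_def]
    exact max_le (by simp) (by simp)
  gcongr
  nlinarith [norm_nonneg x, norm_nonneg y, mul_nonneg (norm_nonneg x) (norm_nonneg y)]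

theorem comp_affine [NormedSpace ℝ E] [BorelSpace E] [SecondCountableTopology E] {f : E → ℝ}
    (hf : PolyGrowth f) (β : ℝ) (x : E) : PolyGrowth fun y : E => f (x + β • y) := by
  simpa [add_comm] using (hf.comp_lincomb β 1).section_fst x

theorem integrable [NormedSpace ℝ E] [BorelSpace E] [CompleteSpace E]
    [SecondCountableTopology E] {f : E → ℝ} (hf : PolyGrowth f) (μ : Measure E) [IsGaussian μ] :
    Integrable f μ := by
  obtain ⟨mf, C, N, hC, hf⟩ := hf
  have h0 : MemLp (fun x : E => ‖x‖) N μ := (IsGaussian.memLp_id μ N (by simp)).norm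
  have h1 : MemLp (fun x : E => 1 + ‖x‖) N μ := (memLp_const (1 : ℝ)).add h0
  have h2 : Integrable (fun x : E => C * (1 + ‖x‖) ^ N) μ := by
    refine Integrable.const_mul ?_ C
    have := h1.integrable_norm_pow'
    refine this.congr (ae_of_all _ fun x => ?_)
    simp only [Real.norm_eq_abs]
    rw [abs_of_nonneg (by positivity)]
  exact h2.mono' mf.aestronglyMeasurable (ae_of_all _ hf)

theorem integral_snd [NormedSpace ℝ F] [BorelSpace F] [CompleteSpace F]
    [SecondCountableTopology F] {f : E × F → ℝ} (hf : PolyGrowth f) (μ : Measure F)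
    [IsGaussian μ] : PolyGrowth fun x => ∫ y, f (x, y) ∂μ := by
  obtain ⟨mf, C, N, hC, hf⟩ := hf
  have hI : Integrable (fun y : F => (1 + ‖y‖) ^ N) μ := by
    refine PolyGrowth.integrable ⟨by fun_prop, 1, N, zero_le_one, fun x => ?_⟩ μ
    rw [abs_of_nonneg (by positivity), one_mul]
  refine ⟨(StronglyMeasurable.integral_prod_right (f := fun x y => f (x, y))
    mf.stronglyMeasurable (ν := μ)).measurable,
    C * ∫ y, (1 + ‖y‖) ^ N ∂μ, N, by positivity, fun x => ?_⟩
  rw [← Real.norm_eq_abs]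
  calc ‖∫ y, f (x, y) ∂μ‖ ≤ ∫ y, C * (1 + ‖x‖) ^ N * (1 + ‖y‖) ^ N ∂μ := by
        refine norm_integral_le_of_norm_le (hI.const_mul _) (ae_of_all _ fun y => ?_)
        refine (hf _).trans ?_
        rw [mul_assoc, ← mul_pow]
        have : ‖(x, y)‖ ≤ ‖x‖ + ‖y‖ := by
          rw [Prod.norm_def]
          exact max_le (by simp) (by simp)
        gcongr
        nlinarith [norm_nonneg x, norm_nonneg y, mul_nonneg (norm_nonneg x) (norm_nonneg y)]
    _ = _ := by rw [integral_const_mul]; ring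

theorem apply {ι : Type*} [Fintype ι] (i : ι) : PolyGrowth fun x : ι → ℝ => x i :=
  ⟨measurable_pi_apply i, 1, 1, zero_le_one, fun x => by
    have := norm_le_pi_norm x i
    rw [Real.norm_eq_abs] at this
    linarith⟩

theorem eval {n : ℕ} (p : MvPolynomial (Fin n) ℝ) :
    PolyGrowth fun x : Fin n → ℝ => MvPolynomial.eval x p := by
  induction p using MvPolynomial.induction_on with
  | C a => simpa using const a
  | add p q hp hq => simpa using hp.add hq
  | mul_X p i hp =>
    simpa using hp.mul (PolyGrowth.apply i)

end PolyGrowth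

instance isGaussian_gaussianPi (ι : Type*) [Fintype ι] : IsGaussian (gaussianPi ι) := by
  have h := iIndepFun.hasGaussianLaw (P := gaussianPi ι) (X := fun (i : ι) (x : ι → ℝ) => x i)
    (fun i => ⟨by
      rw [gaussianPi, (measurePreserving_eval (fun _ : ι => gaussianReal 0 1) i).map_eq]
      infer_instance⟩)
    (by
      unfold gaussianPi
      exact iIndepFun_pi (μ := fun _ : ι => gaussianReal 0 1) (X := fun _ x => x)
        fun _ => aemeasurable_id)
  simpa using h.isGaussian_map

theorem integral_id_gaussianPi (ι : Type*) [Fintype ι] : ∫ x, id x ∂gaussianPi ι = 0 := by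
  have hp : ∀ i, PolyGrowth fun x : ι → ℝ => x i := fun i => PolyGrowth.apply i
  ext i
  simp only [id]
  rw [eval_integral fun j => (hp j).integrable _]
  have h := integral_map (μ := gaussianPi ι) (φ := fun x : ι → ℝ => x i) (f := fun y : ℝ => y)
    (measurable_pi_apply i).aemeasurable aestronglyMeasurable_id
  rw [gaussianPi, (measurePreserving_eval (fun _ : ι => gaussianReal 0 1) i).map_eq,
    integral_id_gaussianReal] at h
  exact h.symm

theorem sq_integral_mul_le {Ω : Type*} [MeasurableSpace Ω] {μ : Measure Ω} {f g : Ω → ℝ}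
    (hf : Integrable (fun x => f x ^ 2) μ) (hg : Integrable (fun x => g x ^ 2) μ)
    (hfg : Integrable (fun x => f x * g x) μ) :
    (∫ x, f x * g x ∂μ) ^ 2 ≤ (∫ x, f x ^ 2 ∂μ) * ∫ x, g x ^ 2 ∂μ := by
  have h : ∀ t : ℝ, 0 ≤ (∫ x, g x ^ 2 ∂μ) * (t * t) + (2 * ∫ x, f x * g x ∂μ) * t
      + ∫ x, f x ^ 2 ∂μ := fun t => by
    have h0 : 0 ≤ ∫ x, (f x + t * g x) ^ 2 ∂μ := integral_nonneg fun x => sq_nonneg _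
    have h1 : ∫ x, (f x + t * g x) ^ 2 ∂μ
        = ∫ x, (f x ^ 2 + 2 * t * (f x * g x)) + t * t * g x ^ 2 ∂μ := by
      congr 1; ext x; ring
    rw [h1, integral_add (f := fun x => f x ^ 2 + 2 * t * (f x * g x)) (hf.add (hfg.const_mul _))
      (hg.const_mul _),
      integral_add hf (hfg.const_mul _), integral_const_mul, integral_const_mul] at h0
    linarith
  have := discrim_le_zero h
  rw [discrim] at this
  linarith

section Hypercontractivity

variable {E : Type*} [NormedAddCommGroup E] [NormedSpace ℝ E] [MeasurableSpace E] [BorelSpace E]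
  [CompleteSpace E] [SecondCountableTopology E] {μ : Measure E} [IsGaussian μ]

theorem integral_integral_rotation (hμ : ∫ x, id x ∂μ = 0) {F : E × E → ℝ} (hF : PolyGrowth F)
    {α β : ℝ} (h : α ^ 2 + β ^ 2 = 1) (hβ : 0 ≤ β) :
    ∫ x, ∫ y, F (α • x + β • y, -β • x + α • y) ∂μ ∂μ = ∫ x, ∫ y, F (x, y) ∂μ ∂μ := by
  have hc : Real.cos (Real.arccos α) = α := Real.cos_arccos (by nlinarith) (by nlinarith)
  have hs : Real.sin (Real.arccos α) = β := by
    rw [Real.sin_arccos, ← h, add_sub_cancel_left, Real.sqrt_sq hβ]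
  have hrot := IsGaussian.map_rotation_eq_self hμ (Real.arccos α)
  have hF' := hF.comp_clm (ContinuousLinearMap.rotation (Real.arccos α))
  rw [← integral_prod _ (hF.integrable (μ.prod μ))]
  conv_rhs => rw [← hrot]
  rw [integral_map (by fun_prop) hF.1.aestronglyMeasurable,
    integral_prod _ (hF'.integrable (μ.prod μ))]
  simp only [ContinuousLinearMap.rotation_apply, hc, hs]

/-- The Gaussian noise operator with coefficients `α`, `β`. -/
def noise (μ : Measure E) (α β : ℝ) (f : E → ℝ) (x : E) : ℝ := ∫ y, f (α • x + β • y) ∂μ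

theorem integral_noise_pow_four_le (hμ : ∫ x, id x ∂μ = 0) {f : E → ℝ} (hf : PolyGrowth f)
    {s ρ c : ℝ} (hs0 : 0 ≤ s) (hρ0 : 0 ≤ ρ) (hs : s ^ 2 + s ^ 2 = 1) (hcs : c * s = ρ)
    (hρ : ρ ^ 2 + c ^ 2 = 1) :
    ∫ x, noise μ ρ c f x ^ 4 ∂μ ≤ (∫ x, f x ^ 2 ∂μ) ^ 2 := by
  let M : E × E → ℝ := fun z => ∫ a, f (c • z.1 + ρ • a) * f (c • z.2 + ρ • a) ∂μ
  have hM : PolyGrowth M := by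
    refine PolyGrowth.integral_snd
      (f := fun w : (E × E) × E => f (c • w.1.1 + ρ • w.2) * f (c • w.1.2 + ρ • w.2)) ?_ μ
    let A := ContinuousLinearMap.fst ℝ (E × E) E
    let B := ContinuousLinearMap.snd ℝ (E × E) E
    exact (hf.comp_clm (c • (ContinuousLinearMap.fst ℝ E E ∘L A) + ρ • B)).mul
      (hf.comp_clm (c • (ContinuousLinearMap.snd ℝ E E ∘L A) + ρ • B))
  have hMrot : PolyGrowth fun z : E × E => M (s • z.1 + s • z.2, -s • z.1 + s • z.2) :=
    hM.comp_clm ((s • ContinuousLinearMap.fst ℝ E E + s • ContinuousLinearMap.snd ℝ E E).prod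
      (-s • ContinuousLinearMap.fst ℝ E E + s • ContinuousLinearMap.snd ℝ E E))
  have hrep (x : E) : noise μ ρ c f x ^ 2
      = ∫ b, M (s • b + s • x, -s • b + s • x) ∂μ := by
    have hfx := hf.comp_affine c (ρ • x)
    have hF : PolyGrowth fun z : E × E => f (ρ • x + c • z.1) * f (ρ • x + c • z.2) :=
      (hfx.comp_clm (ContinuousLinearMap.fst ℝ E E)).mul
        (hfx.comp_clm (ContinuousLinearMap.snd ℝ E E))
    have h1 := integral_integral_rotation hμ hF hs hs0
    simp only [integral_const_mul, integral_mul_const] at h1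
    rw [sq, noise, ← h1]
    refine integral_congr_ae (ae_of_all _ fun b => integral_congr_ae (ae_of_all _ fun a => ?_))
    simp only [smul_add, smul_smul, hcs, mul_neg]
    congr 2 <;> abel
  have hMs (x : E) : PolyGrowth fun b => M (s • b + s • x, -s • b + s • x) :=
    hMrot.section_fst x
  have hM3 := (hM.pow 2).integrable (μ.prod μ)
  have hMr := (hMrot.pow 2).integrable (μ.prod μ)
  let g : E → ℝ := fun u => ∫ a, f (c • u + ρ • a) ^ 2 ∂μ
  have hfsq : PolyGrowth fun x => f x ^ 2 := hf.pow 2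
  have hg : PolyGrowth g :=
    PolyGrowth.integral_snd (hfsq.comp_lincomb c ρ) μ
  have hgint : ∫ u, g u ∂μ = ∫ x, f x ^ 2 ∂μ := by
    have h1 := integral_integral_rotation hμ
      (hfsq.comp_clm (ContinuousLinearMap.fst ℝ E E)) (α := c) (β := ρ) (by linarith) hρ0
    simpa using h1
  have hMle (u v : E) : M (u, v) ^ 2 ≤ g u * g v := by
    have hu := hf.comp_affine ρ (c • u)
    have hv := hf.comp_affine ρ (c • v)
    exact sq_integral_mul_le ((hu.pow 2).integrable μ) ((hv.pow 2).integrable μ)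
      ((hu.mul hv).integrable μ)
  calc ∫ x, noise μ ρ c f x ^ 4 ∂μ
      ≤ ∫ x, ∫ b, M (s • b + s • x, -s • b + s • x) ^ 2 ∂μ ∂μ := by
        refine integral_mono_of_nonneg (ae_of_all _ fun x => by positivity) ?_
          (ae_of_all _ fun x => ?_)
        · exact hMr.integral_prod_right
        · have := sq_integral_mul_le (((hMs x).pow 2).integrable μ) (g := fun _ => 1) (by simp)
            (by simpa using (hMs x).integrable μ)
          simp only [mul_one, one_pow, integral_const, probReal_univ, smul_eq_mul] at this
          rw [← hrep] at this
          calc noise μ ρ c f x ^ 4 = (noise μ ρ c f x ^ 2) ^ 2 := by ring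
            _ ≤ _ := this
    _ = ∫ b, ∫ x, M (s • b + s • x, -s • b + s • x) ^ 2 ∂μ ∂μ := (integral_integral_swap hMr).symm
    _ = ∫ u, ∫ v, M (u, v) ^ 2 ∂μ ∂μ := integral_integral_rotation hμ (hM.pow 2) hs hs0
    _ ≤ ∫ u, ∫ v, g u * g v ∂μ ∂μ := by
        have hgi := hg.integrable μ
        rw [← integral_prod _ hM3, ← integral_prod (fun z : E × E => g z.1 * g z.2)
          (hgi.mul_prod hgi)]
        exact integral_mono hM3 (hgi.mul_prod hgi) fun z => hMle z.1 z.2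
    _ = _ := by
        simp only [integral_const_mul, integral_mul_const, hgint]
        ring

end Hypercontractivity

section Polynomials

variable {n : ℕ}

theorem integrable_eval (p : MvPolynomial (Fin n) ℝ) :
    Integrable (fun x => eval x p) (gaussianPi (Fin n)) :=
  (PolyGrowth.eval p).integrable _

theorem gExp_add (p q : MvPolynomial (Fin n) ℝ) : gExp (p + q) = gExp p + gExp q := by
  simp only [gExp, map_add]
  exact integral_add (integrable_eval p) (integrable_eval q)

theorem gExp_C_mul (a : ℝ) (p : MvPolynomial (Fin n) ℝ) : gExp (C a * p) = a * gExp p := by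
  simp only [gExp, map_mul, eval_C, integral_const_mul]

theorem gExp_sq_nonneg (p : MvPolynomial (Fin n) ℝ) : 0 ≤ gExp (p * p) :=
  integral_nonneg fun x => by simpa using mul_self_nonneg (eval x p)

/-- Polynomials of total degree less than `k`. -/
def degreeLT (n k : ℕ) : Submodule ℝ (MvPolynomial (Fin n) ℝ) :=
  restrictSupport ℝ {s | s.degree < k}

theorem degreeLT_mono {k l : ℕ} (h : k ≤ l) : degreeLT n k ≤ degreeLT n l :=
  restrictSupport_mono ℝ fun _ hs => lt_of_lt_of_le hs h

theorem mem_degreeLT_of_totalDegree_le {p : MvPolynomial (Fin n) ℝ} {d : ℕ}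
    (hp : p.totalDegree ≤ d) : p ∈ degreeLT n (d + 1) := by
  rw [degreeLT, mem_restrictSupport_iff]
  intro s hs
  exact Nat.lt_succ_of_le ((le_totalDegree hs).trans hp)

theorem mul_X_mem_degreeLT {p : MvPolynomial (Fin n) ℝ} {k : ℕ} (hp : p ∈ degreeLT n k)
    (i : Fin n) : p * X i ∈ degreeLT n (k + 1) := by
  rw [degreeLT, mem_restrictSupport_iff] at hp ⊢
  rw [support_mul_X]
  intro s hs
  simp only [Finset.coe_map, Set.mem_image, addRightEmbedding_apply] at hs
  obtain ⟨t, ht, rfl⟩ := hs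
  have := hp ht
  simpa using this

theorem monomial_mem_degreeLT {s : Fin n →₀ ℕ} {k : ℕ} (h : s.degree < k) (a : ℝ) :
    monomial s a ∈ degreeLT n k :=
  (monomial_mem_restrictSupport ℝ).2 (Or.inl h)

theorem C_mul_mem_degreeLT {p : MvPolynomial (Fin n) ℝ} {k : ℕ} (hp : p ∈ degreeLT n k) (a : ℝ) :
    C a * p ∈ degreeLT n k := by
  rw [← smul_eq_C_mul]
  exact Submodule.smul_mem _ _ hp

theorem degreeLT_zero : degreeLT n 0 = ⊥ := by
  simp [degreeLT, restrictSupport_eq_span]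

instance finiteDimensional_degreeLT (k : ℕ) : FiniteDimensional ℝ (degreeLT n k) := by
  rw [degreeLT, restrictSupport_eq_span]
  exact FiniteDimensional.span_of_finite ℝ ((Finsupp.finite_of_degree_lt k).image _)

theorem integrable_mul_eval_lincomb (m p : MvPolynomial (Fin n) ℝ) (α β : ℝ) (x : Fin n → ℝ) :
    Integrable (fun y => eval y m * eval (α • x + β • y) p) (gaussianPi (Fin n)) :=
  ((PolyGrowth.eval m).mul ((PolyGrowth.eval p).comp_affine β (α • x))).integrable _

theorem exists_integral_mul_monomial (α β : ℝ) (k : ℕ) : ∀ s : Fin n →₀ ℕ, s.degree = k →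
    ∀ m : MvPolynomial (Fin n) ℝ, ∃ q ∈ degreeLT n k, ∀ x,
      ∫ y, eval y m * eval (α • x + β • y) (monomial s 1) ∂gaussianPi (Fin n) =
        α ^ k * gExp m * eval x (monomial s 1) + eval x q := by
  induction k with
  | zero =>
    intro s hs m
    obtain rfl : s = 0 := (Finsupp.degree_eq_zero_iff s).1 hs
    exact ⟨0, Submodule.zero_mem _, fun x => by simp [gExp]⟩
  | succ k ih =>
    intro s hs m
    obtain ⟨i, hi⟩ : ∃ i, s i ≠ 0 := by
      by_contra! h
      obtain rfl : s = 0 := Finsupp.ext h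
      simp at hs
    obtain ⟨t, rfl⟩ : ∃ t, s = t + Finsupp.single i 1 :=
      ⟨s - Finsupp.single i 1, (tsub_add_cancel_of_le (by
        simpa [Nat.one_le_iff_ne_zero] using hi)).symm⟩
    have ht : t.degree = k := by simpa using hs
    obtain ⟨q₁, hq₁, h₁⟩ := ih t ht m
    obtain ⟨q₂, hq₂, h₂⟩ := ih t ht (m * X i)
    refine ⟨C α * (q₁ * X i) + C β * (C (α ^ k * gExp (m * X i)) * monomial t 1 + q₂), ?_,
      fun x => ?_⟩
    · refine Submodule.add_mem _ (C_mul_mem_degreeLT (mul_X_mem_degreeLT hq₁ i) _)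
        (C_mul_mem_degreeLT (Submodule.add_mem _ (C_mul_mem_degreeLT ?_ _)
          (degreeLT_mono k.le_succ hq₂)) _)
      exact monomial_mem_degreeLT (by omega) _
    · have hmon : (monomial (t + Finsupp.single i 1) (1 : ℝ)) = monomial t 1 * X i := by
        rw [X, monomial_mul, one_mul]
      have hint : ∀ y, eval y m * eval (α • x + β • y) (monomial t (1 : ℝ) * X i)
          = α * x i * (eval y m * eval (α • x + β • y) (monomial t 1))
            + β * (eval y (m * X i) * eval (α • x + β • y) (monomial t 1)) := fun y => by
        simp only [map_mul, eval_X, Pi.add_apply, Pi.smul_apply, smul_eq_mul]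
        ring
      rw [hmon]
      simp_rw [hint]
      rw [integral_add ((integrable_mul_eval_lincomb _ _ _ _ _).const_mul _)
        ((integrable_mul_eval_lincomb _ _ _ _ _).const_mul _), integral_const_mul,
        integral_const_mul, h₁, h₂]
      simp only [map_add, map_mul, eval_X, eval_C]
      ring

theorem exists_noise_eq (α β : ℝ) {k : ℕ} {p : MvPolynomial (Fin n) ℝ}
    (hp : p ∈ degreeLT n (k + 1)) : ∃ q ∈ degreeLT n k, ∀ x,
      noise (gaussianPi (Fin n)) α β (fun x => eval x p) x = α ^ k * eval x p + eval x q := by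
  rw [degreeLT, restrictSupport_eq_span] at hp
  induction hp using Submodule.span_induction with
  | mem p hp =>
    obtain ⟨s, hs, rfl⟩ := hp
    obtain ⟨q, hq, h⟩ := exists_integral_mul_monomial α β s.degree s rfl 1
    have h1 : gExp (1 : MvPolynomial (Fin n) ℝ) = 1 := by simp [gExp]
    have hsk : s.degree ≤ k := Nat.lt_succ_iff.1 hs
    refine ⟨C (α ^ s.degree - α ^ k) * monomial s 1 + q, ?_, fun x => ?_⟩
    · refine Submodule.add_mem _ ?_ (degreeLT_mono hsk hq)
      rcases hsk.eq_or_lt with h | h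
      · simp [h]
      · exact C_mul_mem_degreeLT (monomial_mem_degreeLT h _) _
    · have := h x
      simp only [map_one, one_mul, h1, mul_one] at this
      rw [noise, this, map_add, map_mul, eval_C]
      ring
  | zero => exact ⟨0, Submodule.zero_mem _, by simp [noise]⟩
  | add p r _ _ hp hr =>
    obtain ⟨q, hq, h⟩ := hp
    obtain ⟨q', hq', h'⟩ := hr
    refine ⟨q + q', Submodule.add_mem _ hq hq', fun x => ?_⟩
    have hadd : noise (gaussianPi (Fin n)) α β (fun x => eval x (p + r)) x =
        noise (gaussianPi (Fin n)) α β (fun x => eval x p) x +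
        noise (gaussianPi (Fin n)) α β (fun x => eval x r) x := by
      simp only [noise, map_add]
      exact integral_add (((PolyGrowth.eval p).comp_affine β (α • x)).integrable _)
        (((PolyGrowth.eval r).comp_affine β (α • x)).integrable _)
    rw [hadd, h, h', map_add, map_add]
    ring
  | smul a p _ hp =>
    obtain ⟨q, hq, h⟩ := hp
    refine ⟨a • q, Submodule.smul_mem _ _ hq, fun x => ?_⟩
    have hsmul : noise (gaussianPi (Fin n)) α β (fun x => eval x (a • p)) x =
        a * noise (gaussianPi (Fin n)) α β (fun x => eval x p) x := by
      simp only [noise, smul_eval, integral_const_mul]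
    rw [hsmul, h, smul_eval, smul_eval]
    ring

theorem exists_mem_degreeLT_noise_eq (α β : ℝ) {k : ℕ} {p : MvPolynomial (Fin n) ℝ}
    (hp : p ∈ degreeLT n k) : ∃ q ∈ degreeLT n k, ∀ x,
      noise (gaussianPi (Fin n)) α β (fun x => eval x p) x = eval x q := by
  cases k with
  | zero =>
    rw [degreeLT_zero, Submodule.mem_bot] at hp
    exact ⟨0, Submodule.zero_mem _, by simp [noise, hp]⟩
  | succ k =>
    obtain ⟨q, hq, h⟩ := exists_noise_eq α β hp
    exact ⟨C (α ^ k) * p + q, Submodule.add_mem _ (C_mul_mem_degreeLT hp _)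
      (degreeLT_mono k.le_succ hq), fun x => by simp [h]⟩

theorem memLp_eval (p : MvPolynomial (Fin n) ℝ) :
    MemLp (fun x => eval x p) 2 (gaussianPi (Fin n)) :=
  (memLp_two_iff_integrable_sq (PolyGrowth.eval p).1.aestronglyMeasurable).2
    (((PolyGrowth.eval p).pow 2).integrable _)

/-- Polynomials as elements of `L²(γ)`. -/
def evalLp (n : ℕ) : MvPolynomial (Fin n) ℝ →ₗ[ℝ] Lp ℝ 2 (gaussianPi (Fin n)) where
  toFun p := (memLp_eval p).toLp
  map_add' p q := by
    rw [← MemLp.toLp_add]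
    exact MemLp.toLp_congr _ _ (ae_of_all _ fun x => by simp)
  map_smul' a p := by
    rw [RingHom.id_apply, ← MemLp.toLp_const_smul]
    exact MemLp.toLp_congr _ _ (ae_of_all _ fun x => by simp)

theorem inner_evalLp (p q : MvPolynomial (Fin n) ℝ) :
    inner ℝ (evalLp n p) (evalLp n q) = gExp (p * q) := by
  rw [L2.inner_def, gExp]
  refine integral_congr_ae ?_
  filter_upwards [(memLp_eval p).coeFn_toLp, (memLp_eval q).coeFn_toLp] with x hp hq
  change inner ℝ ((memLp_eval p).toLp _ x) ((memLp_eval q).toLp _ x) = _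
  rw [hp, hq]
  simp [mul_comm]

theorem exists_orthogonal_degreeLT (k : ℕ) (f : MvPolynomial (Fin n) ℝ) :
    ∃ r ∈ degreeLT n k, ∀ p ∈ degreeLT n k, gExp ((f - r) * p) = 0 := by
  let K := (degreeLT n k).map (evalLp n)
  obtain ⟨r, hr, h⟩ := Submodule.mem_map.1 (K.starProjection_apply_mem (evalLp n f))
  refine ⟨r, hr, fun p hp => ?_⟩
  rw [← inner_evalLp, map_sub, h, real_inner_comm]
  exact K.sub_starProjection_mem_orthogonal (evalLp n f) _ (Submodule.mem_map_of_mem hp)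

theorem integral_mul_noise (p q : MvPolynomial (Fin n) ℝ) {α β : ℝ} (h : α ^ 2 + β ^ 2 = 1)
    (hβ : 0 ≤ β) :
    ∫ x, eval x p * noise (gaussianPi (Fin n)) α β (fun x => eval x q) x ∂gaussianPi (Fin n) =
      ∫ x, eval x q * noise (gaussianPi (Fin n)) α (-β) (fun x => eval x p) x
        ∂gaussianPi (Fin n) := by
  have hq : PolyGrowth fun z : (Fin n → ℝ) × (Fin n → ℝ) => eval z.1 q :=
    (PolyGrowth.eval q).comp_clm (ContinuousLinearMap.fst ℝ (Fin n → ℝ) (Fin n → ℝ))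
  have hF : PolyGrowth fun z : (Fin n → ℝ) × (Fin n → ℝ) =>
      eval z.1 q * eval (α • z.1 + (-β) • z.2) p :=
    hq.mul ((PolyGrowth.eval p).comp_lincomb α (-β))
  have hrot := integral_integral_rotation (integral_id_gaussianPi (Fin n)) hF h hβ
  have hx (x y : Fin n → ℝ) : α • (α • x + β • y) + (-β) • (-β • x + α • y) = x := by
    ext i
    simp only [Pi.add_apply, Pi.smul_apply, smul_eq_mul]
    linear_combination x i * h
  simp only [hx, integral_const_mul, integral_mul_const] at hrot
  refine Eq.trans ?_ hrot
  simp only [noise, mul_comm]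

theorem noise_ae_eq_of_orthogonal {α β : ℝ} (h : α ^ 2 + β ^ 2 = 1) (hβ : 0 ≤ β) {k : ℕ}
    {f : MvPolynomial (Fin n) ℝ} (hf : f ∈ degreeLT n (k + 1))
    (horth : ∀ p ∈ degreeLT n k, gExp (f * p) = 0) :
    noise (gaussianPi (Fin n)) α β (fun x => eval x f) =ᵐ[gaussianPi (Fin n)]
      fun x => α ^ k * eval x f := by
  obtain ⟨q, hq, hqf⟩ := exists_noise_eq α β hf
  obtain ⟨q', hq', hqq'⟩ := exists_mem_degreeLT_noise_eq α (-β) hq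
  have h1 := integral_mul_noise q f h hβ
  have h2 : gExp (q * (C (α ^ k) * f + q)) = gExp (f * q') := by
    simpa [gExp, hqf, hqq'] using h1
  rw [horth q' hq', show q * (C (α ^ k) * f + q) = C (α ^ k) * (f * q) + q * q by ring, gExp_add,
    gExp_C_mul, horth q hq, mul_zero, zero_add] at h2
  have h3 : (fun x => eval x (q * q)) =ᵐ[gaussianPi (Fin n)] 0 :=
    (integral_eq_zero_iff_of_nonneg (fun x => by simpa using mul_self_nonneg (eval x q))
      (integrable_eval _)).1 h2
  filter_upwards [h3] with x hx
  have hx0 : eval x q = 0 := by simpa using hx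
  rw [hqf, hx0, add_zero]

/-- The noise operator is invertible on polynomials of bounded degree, with explicit norm bound. -/
theorem exists_noise_ae_eq {ρ c : ℝ} (hρc : ρ ^ 2 + c ^ 2 = 1) (hc : 0 ≤ c) (hρ : 0 < ρ) (k : ℕ) :
    ∀ f ∈ degreeLT n k, ∃ g ∈ degreeLT n k,
      noise (gaussianPi (Fin n)) ρ c (fun x => eval x g) =ᵐ[gaussianPi (Fin n)]
        (fun x => eval x f) ∧ gExp (g * g) ≤ ((ρ ^ 2)⁻¹) ^ (k - 1) * gExp (f * f) := by
  have hA : 1 ≤ (ρ ^ 2)⁻¹ := (one_le_inv₀ (by positivity)).2 (by nlinarith)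
  induction k with
  | zero =>
    intro f hf
    rw [degreeLT_zero, Submodule.mem_bot] at hf
    exact ⟨0, Submodule.zero_mem _, by
      filter_upwards with x
      simp [noise, hf], by simp [hf]⟩
  | succ k ih =>
    intro f hf
    obtain ⟨r, hr, horth⟩ := exists_orthogonal_degreeLT k f
    obtain ⟨t, ht, htr, hle⟩ := ih r hr
    have hfr : f - r ∈ degreeLT n (k + 1) := Submodule.sub_mem _ hf (degreeLT_mono k.le_succ hr)
    have hT := noise_ae_eq_of_orthogonal hρc hc hfr horth
    refine ⟨C (ρ ^ k)⁻¹ * (f - r) + t, Submodule.add_mem _ (C_mul_mem_degreeLT hfr _)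
      (degreeLT_mono k.le_succ ht), ?_, ?_⟩
    · filter_upwards [hT, htr] with x h1 h2
      have hsplit : noise (gaussianPi (Fin n)) ρ c
          (fun x => eval x (C (ρ ^ k)⁻¹ * (f - r) + t)) x =
          (ρ ^ k)⁻¹ * noise (gaussianPi (Fin n)) ρ c (fun x => eval x (f - r)) x +
          noise (gaussianPi (Fin n)) ρ c (fun x => eval x t) x := by
        simp only [noise, map_add, map_mul, eval_C]
        rw [integral_add ((((PolyGrowth.eval (f - r)).comp_affine c (ρ • x)).integrable _).const_mul
          _) (((PolyGrowth.eval t).comp_affine c (ρ • x)).integrable _), integral_const_mul]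
      rw [hsplit, h1, h2, inv_mul_cancel_left₀ (by positivity), map_sub, sub_add_cancel]
    · have e1 : gExp ((C (ρ ^ k)⁻¹ * (f - r) + t) * (C (ρ ^ k)⁻¹ * (f - r) + t)) =
          ((ρ ^ 2)⁻¹) ^ k * gExp ((f - r) * (f - r)) + gExp (t * t) := by
        rw [show (C (ρ ^ k)⁻¹ * (f - r) + t) * (C (ρ ^ k)⁻¹ * (f - r) + t) =
            C (ρ ^ k)⁻¹ * (C (ρ ^ k)⁻¹ * ((f - r) * (f - r)))
              + (C (ρ ^ k)⁻¹ * ((f - r) * t) + C (ρ ^ k)⁻¹ * ((f - r) * t)) + t * t by ring,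
          gExp_add, gExp_add, gExp_add, gExp_C_mul, gExp_C_mul, gExp_C_mul, horth t ht]
        rw [inv_pow, ← pow_mul, mul_comm 2 k, pow_mul]
        ring
      have e2 : gExp (f * f) = gExp ((f - r) * (f - r)) + gExp (r * r) := by
        rw [show f * f = (f - r) * (f - r) + ((f - r) * r + (f - r) * r) + r * r by ring,
          gExp_add, gExp_add, gExp_add, horth r hr]
        ring
      have e3 : ((ρ ^ 2)⁻¹) ^ (k - 1) ≤ ((ρ ^ 2)⁻¹) ^ k := pow_le_pow_right₀ hA (Nat.sub_le k 1)
      rw [e1, e2, mul_add, Nat.add_sub_cancel]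
      gcongr
      exact hle.trans (mul_le_mul_of_nonneg_right e3 (gExp_sq_nonneg r))

/-- Gaussian `(2, 4)`-hypercontractivity for polynomials. -/
theorem integral_eval_pow_four_le {d : ℕ} {f : MvPolynomial (Fin n) ℝ} (hf : f.totalDegree ≤ d) :
    ∫ x, eval x f ^ 4 ∂gaussianPi (Fin n) ≤
      9 ^ d * (∫ x, eval x f ^ 2 ∂gaussianPi (Fin n)) ^ 2 := by
  have hρ : (√(1 / 3 : ℝ)) ^ 2 = 1 / 3 := Real.sq_sqrt (by norm_num)
  have hc : (√(2 / 3 : ℝ)) ^ 2 = 2 / 3 := Real.sq_sqrt (by norm_num)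
  have hs : (√(1 / 2 : ℝ)) ^ 2 = 1 / 2 := Real.sq_sqrt (by norm_num)
  have hρc : (√(1 / 3 : ℝ)) ^ 2 + (√(2 / 3 : ℝ)) ^ 2 = 1 := by rw [hρ, hc]; norm_num
  have hcs : √(2 / 3 : ℝ) * √(1 / 2) = √(1 / 3) := by
    rw [← Real.sqrt_mul (by norm_num)]
    norm_num
  obtain ⟨g, -, hg, hle⟩ := exists_noise_ae_eq hρc (Real.sqrt_nonneg _)
    (Real.sqrt_pos.2 (by norm_num)) (d + 1) f (mem_degreeLT_of_totalDegree_le hf)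
  have hsq (p : MvPolynomial (Fin n) ℝ) :
      gExp (p * p) = ∫ x, eval x p ^ 2 ∂gaussianPi (Fin n) := by
    simp only [gExp, map_mul, sq]
  rw [hρ, hsq, hsq, Nat.add_sub_cancel] at hle
  calc ∫ x, eval x f ^ 4 ∂gaussianPi (Fin n)
      = ∫ x, noise (gaussianPi (Fin n)) √(1 / 3) √(2 / 3) (fun x => eval x g) x ^ 4
          ∂gaussianPi (Fin n) := by
        refine integral_congr_ae ?_
        filter_upwards [hg] with x hx
        rw [hx]
    _ ≤ (∫ x, eval x g ^ 2 ∂gaussianPi (Fin n)) ^ 2 :=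
        integral_noise_pow_four_le (integral_id_gaussianPi (Fin n)) (PolyGrowth.eval g)
          (Real.sqrt_nonneg _) (Real.sqrt_nonneg _) (by rw [hs]; norm_num) hcs hρc
    _ ≤ (((1 / 3)⁻¹) ^ d * ∫ x, eval x f ^ 2 ∂gaussianPi (Fin n)) ^ 2 := by
        gcongr
    _ = _ := by
        rw [mul_pow, ← pow_mul, mul_comm d 2, pow_mul]
        norm_num

end Polynomials

end GaussNS

open GaussNS

/-- For polynomials `p, q` of degree at most `d` with `E[q] = 0`,
`E[(p q)²] ≤ 9^d E[p²] E[q²]`. -/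
theorem stmt16 {n d : ℕ} (p q : MvPolynomial (Fin n) ℝ)
    (hp : p.totalDegree ≤ d) (hq : q.totalDegree ≤ d) (hq0 : gExp q = 0) :
    (∫ x, (eval x p * eval x q) ^ 2 ∂gaussianPi (Fin n)) ≤
      9 ^ d * (∫ x, (eval x p) ^ 2 ∂gaussianPi (Fin n)) *
        ∫ x, (eval x q) ^ 2 ∂gaussianPi (Fin n) := by
  have hpI := (PolyGrowth.eval p).pow 2
  have hqI := (PolyGrowth.eval q).pow 2
  have hcs := sq_integral_mul_le ((hpI.pow 2).integrable (gaussianPi (Fin n)))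
    ((hqI.pow 2).integrable (gaussianPi (Fin n)))
    ((hpI.mul hqI).integrable (gaussianPi (Fin n)))
  simp only [← pow_mul, Nat.reduceMul] at hcs
  set A := ∫ x, (eval x p) ^ 2 ∂gaussianPi (Fin n)
  set B := ∫ x, (eval x q) ^ 2 ∂gaussianPi (Fin n)
  have hA : 0 ≤ A := integral_nonneg fun x => sq_nonneg _
  have hB : 0 ≤ B := integral_nonneg fun x => sq_nonneg _
  simp only [mul_pow]
  refine abs_le_of_sq_le_sq' ?_ (by positivity) |>.2
  calc _ ≤ _ := hcs
    _ ≤ (9 ^ d * A ^ 2) * (9 ^ d * B ^ 2) :=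
        mul_le_mul (integral_eval_pow_four_le hp) (integral_eval_pow_four_le hq)
          (integral_nonneg fun x => by positivity) (by positivity)
    _ = _ := by ring
end
end

section
/- Let p, q: ℝⁿ → ℝ be degree-d polynomials with Var_{γ_n}(p) = Var_{γ_n}(q) = 1. Let T = max{E[p²], E[q²]} and L = 4·T·9^{d+1}·(d+1)². Then √(Var(p·q)) ≥ (L/2)·L^{−2^{2d}}. -/
open MeasureTheory ProbabilityTheory MvPolynomial
open scoped Classical

noncomputable section

open GaussNS

section GaussianIntegrals

lemma integrable_pow_gaussianReal (m : ℕ) :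
    Integrable (fun x : ℝ => x ^ m) (gaussianReal 0 1) := by
  rcases Nat.eq_zero_or_pos m with rfl | hm
  · simp
  · have h := (memLp_id_gaussianReal (μ := 0) (v := 1) (m : NNReal)).integrable_norm_pow'
    refine (integrable_norm_iff (by fun_prop)).1 ?_
    simpa using h

lemma integral_pow_succ_gaussianReal (m : ℕ) :
    ∫ x, x ^ (m + 1) ∂gaussianReal 0 1 = m * ∫ x, x ^ (m - 1) ∂gaussianReal 0 1 := by
  have hd : ∀ k : ℕ, Integrable (fun x : ℝ => x ^ k * gaussianPDFReal 0 1 x) := by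
    intro k
    have h := integrable_pow_gaussianReal k
    rw [gaussianReal_of_var_ne_zero 0 one_ne_zero,
      integrable_withDensity_iff_integrable_smul₀' (by fun_prop) (by simp [gaussianPDF])] at h
    refine h.congr (Filter.Eventually.of_forall fun x => ?_)
    simp [toReal_gaussianPDF, mul_comm]
  have hv : ∀ x : ℝ, HasDerivAt (gaussianPDFReal 0 1) (-x * gaussianPDFReal 0 1 x) x := by
    intro x
    have h1 : HasDerivAt (fun y : ℝ => -(y - 0) ^ 2 / (2 * ((1 : NNReal) : ℝ))) (-x) x := by
      have := (((hasDerivAt_id x).sub_const 0).pow 2).neg.div_const (2 * ((1 : NNReal) : ℝ))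
      refine this.congr_deriv ?_
      simp
      ring
    have h2 := (h1.exp).const_mul (√(2 * Real.pi * ((1 : NNReal) : ℝ)))⁻¹
    refine h2.congr_deriv ?_
    simp only [gaussianPDFReal]
    ring
  have key := integral_mul_deriv_eq_deriv_mul_of_integrable
    (u := fun x : ℝ => x ^ m) (u' := fun x : ℝ => m * x ^ (m - 1))
    (v := gaussianPDFReal 0 1) (v' := fun x => -x * gaussianPDFReal 0 1 x)
    (fun x _ => hasDerivAt_pow m x) (fun x _ => hv x)
    (((hd (m + 1)).neg).congr (Filter.Eventually.of_forall fun x => by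
      simp only [Pi.neg_apply, Pi.mul_apply]; ring))
    (((hd (m - 1)).const_mul (m : ℝ)).congr (Filter.Eventually.of_forall fun x => by
      simp only [Pi.mul_apply]; ring))
    (hd m)
  rw [integral_gaussianReal_eq_integral_smul one_ne_zero,
    integral_gaussianReal_eq_integral_smul one_ne_zero, ← integral_const_mul]
  simp only [smul_eq_mul]
  have e1 : ∀ x : ℝ, gaussianPDFReal 0 1 x * x ^ (m + 1)
      = -(x ^ m * (-x * gaussianPDFReal 0 1 x)) := fun x => by ring
  simp_rw [e1]
  rw [integral_neg, key, neg_neg]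
  refine integral_congr_ae (Filter.Eventually.of_forall fun x => ?_)
  ring

variable {σ : Type*} [Fintype σ]

lemma integrable_eval_gaussianPi (p : MvPolynomial σ ℝ) :
    Integrable (fun x => eval x p) (gaussianPi σ) := by
  induction p using MvPolynomial.induction_on' with
  | monomial u a =>
    simp only [eval_monomial, Finsupp.prod_fintype _ _ (fun i => pow_zero _)]
    exact (Integrable.fintype_prod (f := fun i (y : ℝ) => y ^ u i)
      fun i => integrable_pow_gaussianReal (u i)).const_mul a
  | add p q hp hq =>
    simp only [map_add]
    exact hp.add hq

/-- Gaussian expectation as a linear functional on polynomials. -/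
def gaussE : MvPolynomial σ ℝ →ₗ[ℝ] ℝ where
  toFun := gExp
  map_add' p q := by
    simp only [gExp, map_add]
    exact integral_add (integrable_eval_gaussianPi p) (integrable_eval_gaussianPi q)
  map_smul' c p := by
    simp only [gExp, smul_eval, RingHom.id_apply, smul_eq_mul]
    exact integral_const_mul c _

lemma gaussE_apply (p : MvPolynomial σ ℝ) : gaussE p = ∫ x, eval x p ∂gaussianPi σ := rfl

instance : IsProbabilityMeasure (gaussianPi σ) := by
  unfold gaussianPi; infer_instance

lemma gaussE_C (a : ℝ) : gaussE (C a : MvPolynomial σ ℝ) = a := by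
  simp [gaussE_apply]

lemma gaussE_sq_nonneg (p : MvPolynomial σ ℝ) : 0 ≤ gaussE (p ^ 2) := by
  rw [gaussE_apply]
  exact integral_nonneg fun x => by simp only [map_pow]; positivity

lemma gaussE_monomial (u : σ →₀ ℕ) (a : ℝ) :
    gaussE (monomial u a) = a * ∏ i, ∫ x, x ^ u i ∂gaussianReal 0 1 := by
  simp only [gaussE_apply, eval_monomial, Finsupp.prod_fintype _ _ (fun i => pow_zero _)]
  rw [integral_const_mul, gaussianPi, integral_fintype_prod_eq_prod (fun i (y : ℝ) => y ^ u i)]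

lemma gaussE_X_mul (k : σ) (p : MvPolynomial σ ℝ) :
    gaussE (X k * p) = gaussE (pderiv k p) := by
  induction p using MvPolynomial.induction_on' with
  | monomial u a =>
    rw [pderiv_monomial, X, monomial_mul, gaussE_monomial, gaussE_monomial,
      ← Finset.mul_prod_erase _ _ (Finset.mem_univ k),
      ← Finset.mul_prod_erase _ (fun i => ∫ x, x ^ (u - Finsupp.single k 1 : σ →₀ ℕ) i ∂gaussianReal 0 1)
        (Finset.mem_univ k)]
    have h1 : (Finsupp.single k 1 + u : σ →₀ ℕ) k = u k + 1 := by simp [add_comm]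
    have h2 : (u - Finsupp.single k 1 : σ →₀ ℕ) k = u k - 1 := by simp
    rw [h1, h2, integral_pow_succ_gaussianReal]
    have h3 : ∏ x ∈ Finset.univ.erase k, ∫ y, y ^ (Finsupp.single k 1 + u : σ →₀ ℕ) x ∂gaussianReal 0 1
        = ∏ x ∈ Finset.univ.erase k, ∫ y, y ^ (u - Finsupp.single k 1 : σ →₀ ℕ) x ∂gaussianReal 0 1 := by
      refine Finset.prod_congr rfl fun x hx => ?_
      have : k ≠ x := (Finset.ne_of_mem_erase hx).symm
      simp [this]
    rw [h3]
    ring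
  | add p q hp hq => simp [mul_add, hp, hq]

end GaussianIntegrals

section WickMap

variable {σ : Type*} [Fintype σ]

/-- The monic Hermite polynomials for the standard Gaussian weight, over `ℝ`. -/
def realHermite : ℕ → Polynomial ℝ
  | 0 => 1
  | m + 1 => Polynomial.X * realHermite m - Polynomial.derivative (realHermite m)

/-- The linear map sending the monomial `∏ X_k ^ α_k` to `∏ He_{α_k}(X_k)`. It maps homogeneous
polynomials of degree `m` onto the `m`-th Wiener chaos. -/
def wick : MvPolynomial σ ℝ →ₗ[ℝ] MvPolynomial σ ℝ :=
  (basisMonomials σ ℝ).constr ℝ fun α => ∏ k, Polynomial.aeval (X k) (realHermite (α k))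

lemma wick_monomial_one (α : σ →₀ ℕ) :
    wick (monomial α (1 : ℝ)) = ∏ k, Polynomial.aeval (X k) (realHermite (α k)) := by
  have h := (basisMonomials σ ℝ).constr_basis ℝ
    (fun α => ∏ k, Polynomial.aeval (X k : MvPolynomial σ ℝ) (realHermite (α k))) α
  rwa [coe_basisMonomials] at h

lemma wick_one : wick (1 : MvPolynomial σ ℝ) = 1 := by
  have h := wick_monomial_one (0 : σ →₀ ℕ)
  simpa [realHermite] using h

lemma wick_C (a : ℝ) : wick (C a : MvPolynomial σ ℝ) = C a := by
  rw [← mul_one (C a : MvPolynomial σ ℝ), ← smul_eq_C_mul, map_smul, wick_one]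

lemma pderiv_aeval_X_self {σ : Type*} (k : σ) (h : Polynomial ℝ) :
    pderiv k (Polynomial.aeval (X k : MvPolynomial σ ℝ) h)
      = Polynomial.aeval (X k) (Polynomial.derivative h) := by
  rw [Derivation.map_aeval, pderiv_X_self, smul_eq_mul, mul_one]

lemma pderiv_prod_erase_aeval_X (k : σ) (h : σ → Polynomial ℝ) :
    pderiv k (∏ l ∈ Finset.univ.erase k, Polynomial.aeval (X l : MvPolynomial σ ℝ) (h l)) = 0 := by
  refine Finset.prod_induction _ (fun p => pderiv k p = 0)
    (fun a b ha hb => by rw [pderiv_mul, ha, hb, zero_mul, mul_zero, add_zero]) pderiv_one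
    fun l hl => ?_
  rw [Derivation.map_aeval, pderiv_X_of_ne (Finset.ne_of_mem_erase hl), smul_zero]

lemma wick_X_mul (k : σ) (P : MvPolynomial σ ℝ) :
    wick (X k * P) = X k * wick P - pderiv k (wick P) := by
  induction P using MvPolynomial.induction_on' with
  | monomial u a =>
    have hm : ∀ v : σ →₀ ℕ, (monomial v a : MvPolynomial σ ℝ) = a • monomial v 1 := by
      intro v; simp [smul_monomial]
    rw [X, monomial_mul, one_mul, hm, hm u, map_smul, map_smul, Derivation.map_smul,
      mul_smul_comm, ← smul_sub, wick_monomial_one, wick_monomial_one,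
      ← Finset.mul_prod_erase _ _ (Finset.mem_univ k),
      ← Finset.mul_prod_erase _
        (fun l => Polynomial.aeval (X l : MvPolynomial σ ℝ) (realHermite (u l)))
        (Finset.mem_univ k)]
    have h1 : (Finsupp.single k 1 + u : σ →₀ ℕ) k = u k + 1 := by simp [add_comm]
    have h2 : ∏ l ∈ Finset.univ.erase k, Polynomial.aeval (X l : MvPolynomial σ ℝ)
          (realHermite ((Finsupp.single k 1 + u : σ →₀ ℕ) l))
        = ∏ l ∈ Finset.univ.erase k, Polynomial.aeval (X l) (realHermite (u l)) := by
      refine Finset.prod_congr rfl fun l hl => ?_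
      have : k ≠ l := (Finset.ne_of_mem_erase hl).symm
      simp [this]
    rw [h1, h2, realHermite, pderiv_mul, pderiv_prod_erase_aeval_X, pderiv_aeval_X_self, map_sub,
      map_mul, Polynomial.aeval_X, X]
    congr 1
    rw [mul_sub_right_distrib, mul_zero, add_zero, mul_assoc]
  | add p q hp hq =>
    simp only [mul_add, map_add, hp, hq]
    abel

lemma pderiv_comm' {σ : Type*} (k l : σ) (P : MvPolynomial σ ℝ) :
    pderiv k (pderiv l P) = pderiv l (pderiv k P) := by
  ext m
  simp only [coeff_pderiv]
  rcases eq_or_ne k l with rfl | h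
  · rfl
  · simp only [Finsupp.add_apply, Finsupp.single_eq_of_ne h, Finsupp.single_eq_of_ne h.symm,
      add_right_comm m]
    exact mul_right_comm _ _ _

lemma pderiv_wick (k : σ) (P : MvPolynomial σ ℝ) : pderiv k (wick P) = wick (pderiv k P) := by
  induction P using MvPolynomial.induction_on with
  | C a => rw [wick_C, pderiv_C, map_zero]
  | add p q hp hq => simp only [map_add, hp, hq]
  | mul_X p l hp =>
    rw [mul_comm, wick_X_mul, map_sub, pderiv_mul, pderiv_mul, pderiv_comm', hp, map_add,
      wick_X_mul]
    rcases eq_or_ne l k with rfl | h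
    · rw [pderiv_X_self, one_mul, one_mul]
      abel
    · rw [pderiv_X_of_ne h, zero_mul, zero_mul, map_zero, zero_add, zero_add]

lemma gaussE_wick_X_mul_mul (k : σ) (P h : MvPolynomial σ ℝ) :
    gaussE (wick (X k * P) * h) = gaussE (wick P * pderiv k h) := by
  have e := gaussE_X_mul k (wick P * h)
  rw [pderiv_mul, map_add] at e
  rw [wick_X_mul, sub_mul, map_sub, mul_assoc, e]
  abel

lemma sum_gaussE_wick_pderiv_mul {m : ℕ} {P : MvPolynomial σ ℝ} (hP : P.IsHomogeneous m)
    (h : MvPolynomial σ ℝ) :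
    ∑ k, gaussE (wick (pderiv k P) * pderiv k h) = m * gaussE (wick P * h) := by
  simp_rw [← gaussE_wick_X_mul_mul]
  rw [← map_sum, ← Finset.sum_mul, ← map_sum, hP.sum_X_mul_pderiv, map_nsmul, smul_mul_assoc,
    map_nsmul, nsmul_eq_mul]

lemma totalDegree_pderiv_le' {σ : Type*} (k : σ) (P : MvPolynomial σ ℝ) :
    (pderiv k P).totalDegree ≤ P.totalDegree := by
  conv_lhs => rw [← sum_homogeneousComponent P, map_sum]
  refine totalDegree_finsetSum_le fun i hi => ?_
  have := ((homogeneousComponent_isHomogeneous i P).pderiv (i := k)).totalDegree_le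
  have := Finset.mem_range.1 hi
  omega

lemma exists_wick_eq_monomial (u : σ →₀ ℕ) :
    ∃ P : MvPolynomial σ ℝ, P.totalDegree ≤ u.degree ∧ wick P = monomial u 1 := by
  induction hm : u.degree generalizing u with
  | zero =>
    rw [Finsupp.degree_eq_zero_iff] at hm
    subst hm
    exact ⟨1, by simp, by simp [wick_one]⟩
  | succ m ih =>
    obtain ⟨k, hk⟩ : ∃ k, u k ≠ 0 := by
      by_contra! h
      have : u = 0 := Finsupp.ext h
      simp [this] at hm
    have hu : Finsupp.single k 1 + (u - Finsupp.single k 1) = u :=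
      add_tsub_cancel_of_le (Finsupp.single_le_iff.2 (Nat.one_le_iff_ne_zero.2 hk))
    obtain ⟨P, hP, hP'⟩ := ih (u - Finsupp.single k 1) (by
      have := congrArg Finsupp.degree hu
      rw [map_add, Finsupp.degree_single] at this
      omega)
    refine ⟨X k * P + pderiv k P, (totalDegree_add _ _).trans (max_le ?_ ?_), ?_⟩
    · refine (totalDegree_mul _ _).trans ?_
      rw [totalDegree_X]
      omega
    · exact (totalDegree_pderiv_le' k P).trans (by omega)
    · rw [map_add, wick_X_mul, ← pderiv_wick, sub_add_cancel, hP', X, monomial_mul, hu, one_mul]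

lemma exists_wick_eq {d : ℕ} {p : MvPolynomial σ ℝ} (hp : p.totalDegree ≤ d) :
    ∃ P : MvPolynomial σ ℝ, P.totalDegree ≤ d ∧ wick P = p := by
  choose F hF hF' using exists_wick_eq_monomial (σ := σ)
  refine ⟨∑ u ∈ p.support, p.coeff u • F u, totalDegree_finsetSum_le fun u hu => ?_, ?_⟩
  · refine (totalDegree_smul_le _ _).trans ((hF u).trans (le_trans ?_ hp))
    exact le_totalDegree hu
  · rw [map_sum]
    conv_rhs => rw [p.as_sum]
    simp [hF', smul_monomial]

end WickMap

section ChaosInequalities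

variable {σ : Type*} [Fintype σ]

/-- The `L²(γ)` norm of a polynomial. -/
def gNorm (p : MvPolynomial σ ℝ) : ℝ := √(gaussE (p ^ 2))

lemma gNorm_nonneg (p : MvPolynomial σ ℝ) : 0 ≤ gNorm p := Real.sqrt_nonneg _

lemma gNorm_sq (p : MvPolynomial σ ℝ) : gNorm p ^ 2 = gaussE (p ^ 2) :=
  Real.sq_sqrt (gaussE_sq_nonneg p)

lemma gNorm_zero : gNorm (0 : MvPolynomial σ ℝ) = 0 := by simp [gNorm]

lemma gaussE_mul_le (p q : MvPolynomial σ ℝ) : gaussE (p * q) ≤ gNorm p * gNorm q := by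
  have key : ∀ t : ℝ, 0 ≤ gaussE (q ^ 2) * (t * t) + 2 * gaussE (p * q) * t + gaussE (p ^ 2) := by
    intro t
    have h := gaussE_sq_nonneg (p + t • q)
    have e : (p + t • q) ^ 2 = p ^ 2 + (2 * t) • (p * q) + (t * t) • q ^ 2 := by
      simp only [smul_eq_C_mul, C_mul, map_ofNat]
      ring
    rw [e] at h
    simp only [map_add, map_smul, smul_eq_mul] at h
    linarith
  have hd := discrim_le_zero key
  rw [discrim] at hd
  refine (abs_le_of_sq_le_sq' ?_ (mul_nonneg (gNorm_nonneg p) (gNorm_nonneg q))).2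
  rw [mul_pow, gNorm_sq, gNorm_sq]
  linarith

lemma gNorm_add_le (p q : MvPolynomial σ ℝ) : gNorm (p + q) ≤ gNorm p + gNorm q := by
  refine (abs_le_of_sq_le_sq' ?_ (add_nonneg (gNorm_nonneg p) (gNorm_nonneg q))).2
  have e : (p + q) ^ 2 = p ^ 2 + (2 : ℝ) • (p * q) + q ^ 2 := by
    simp only [smul_eq_C_mul, map_ofNat]
    ring
  rw [gNorm_sq, e]
  simp only [map_add, map_smul, smul_eq_mul, ← gNorm_sq]
  linarith [gaussE_mul_le p q]

lemma gNorm_sum_le {ι : Type*} (s : Finset ι) (f : ι → MvPolynomial σ ℝ) :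
    gNorm (∑ i ∈ s, f i) ≤ ∑ i ∈ s, gNorm (f i) :=
  Finset.le_sum_of_subadditive gNorm gNorm_zero.le gNorm_add_le s f

/-- The inner product of `L²(γ)`, transported to Wick symbols. -/
def fock (P Q : MvPolynomial σ ℝ) : ℝ := gaussE (wick P * wick Q)

lemma fock_comm (P Q : MvPolynomial σ ℝ) : fock P Q = fock Q P := by
  rw [fock, fock, mul_comm]

lemma fock_add_right (P Q R : MvPolynomial σ ℝ) : fock P (Q + R) = fock P Q + fock P R := by
  simp only [fock, map_add, mul_add]

lemma fock_self (P : MvPolynomial σ ℝ) : fock P P = gNorm (wick P) ^ 2 := by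
  rw [fock, gNorm_sq, sq]

lemma fock_self_nonneg (P : MvPolynomial σ ℝ) : 0 ≤ fock P P := by
  rw [fock_self]; positivity

lemma fock_C_C (a b : ℝ) : fock (C a : MvPolynomial σ ℝ) (C b) = a * b := by
  rw [fock, wick_C, wick_C, ← C_mul, gaussE_C]

lemma fock_C_mul_C_mul (a b : ℝ) (P Q : MvPolynomial σ ℝ) :
    fock (C a * P) (C b * Q) = a * b * fock P Q := by
  simp only [fock, ← smul_eq_C_mul, map_smul, smul_mul_assoc, mul_smul_comm, smul_eq_mul]
  ring

lemma fock_X_mul (k : σ) (P Q : MvPolynomial σ ℝ) : fock (X k * P) Q = fock P (pderiv k Q) := by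
  rw [fock, gaussE_wick_X_mul_mul, pderiv_wick, fock]

lemma sum_fock_pderiv_mul {m : ℕ} {P : MvPolynomial σ ℝ} (hP : P.IsHomogeneous m)
    (S R : MvPolynomial σ ℝ) :
    ∑ k, fock (pderiv k P * S) (pderiv k R) = m * fock (P * S) R := by
  simp_rw [← fock_X_mul, ← mul_assoc, fock]
  rw [← map_sum, ← Finset.sum_mul, ← map_sum, ← Finset.sum_mul, hP.sum_X_mul_pderiv,
    smul_mul_assoc, map_nsmul, smul_mul_assoc, map_nsmul, nsmul_eq_mul]

lemma sum_fock_pderiv {m : ℕ} {P : MvPolynomial σ ℝ} (hP : P.IsHomogeneous m)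
    (R : MvPolynomial σ ℝ) :
    ∑ k, fock (pderiv k P) (pderiv k R) = m * fock P R := by
  simpa using sum_fock_pderiv_mul hP 1 R

lemma fock_eq_zero {a b : ℕ} (hab : a ≠ b) {P Q : MvPolynomial σ ℝ} (hP : P.IsHomogeneous a)
    (hQ : Q.IsHomogeneous b) : fock P Q = 0 := by
  have h1 := sum_fock_pderiv hP Q
  have h2 := sum_fock_pderiv hQ P
  simp_rw [fock_comm _ (pderiv _ P)] at h2
  rw [h1, fock_comm Q P] at h2
  have : ((a : ℝ) - b) * fock P Q = 0 := by linarith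
  rcases mul_eq_zero.1 this with h | h
  · exact absurd (by exact_mod_cast sub_eq_zero.1 h) hab
  · exact h

lemma IsHomogeneous.exists_eq_C {σ : Type*} {P : MvPolynomial σ ℝ} (hP : P.IsHomogeneous 0) :
    ∃ a, P = C a :=
  ⟨_, totalDegree_eq_zero_iff_eq_C.1 (Nat.le_zero.1 hP.totalDegree_le)⟩

/-- Hypercontractivity for products of two elements of Wiener chaoses. -/
lemma gaussE_wick_mul_wick_sq_le (N : ℕ) : ∀ {a b : ℕ} {F G : MvPolynomial σ ℝ}, a + b = N →
    F.IsHomogeneous a → G.IsHomogeneous b →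
    gaussE ((wick F * wick G) ^ 2) ≤ 3 ^ N * (fock F F * fock G G) := by
  induction N with
  | zero =>
    intro a b F G hab hF hG
    obtain ⟨rfl, rfl⟩ : a = 0 ∧ b = 0 := by omega
    obtain ⟨x, rfl⟩ := IsHomogeneous.exists_eq_C hF
    obtain ⟨y, rfl⟩ := IsHomogeneous.exists_eq_C hG
    rw [wick_C, wick_C, ← C_mul, ← C_pow, gaussE_C, fock_C_C, fock_C_C]
    linarith
  | succ N ih =>
    intro a b F G hab hF hG
    have hX : ∑ k, gaussE ((wick (pderiv k F) * wick G) ^ 2)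
        ≤ 3 ^ N * (a * (fock F F * fock G G)) := by
      rcases Nat.eq_zero_or_pos a with rfl | ha
      · obtain ⟨x, rfl⟩ := IsHomogeneous.exists_eq_C hF
        simp
      · calc _ ≤ ∑ k, 3 ^ N * (fock (pderiv k F) (pderiv k F) * fock G G) :=
              Finset.sum_le_sum fun k _ => ih (by omega) hF.pderiv hG
          _ = _ := by
            rw [← Finset.mul_sum, ← Finset.sum_mul, sum_fock_pderiv hF]
            ring
    have hY : ∑ k, gaussE ((wick F * wick (pderiv k G)) ^ 2)
        ≤ 3 ^ N * (b * (fock F F * fock G G)) := by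
      rcases Nat.eq_zero_or_pos b with rfl | hb
      · obtain ⟨x, rfl⟩ := IsHomogeneous.exists_eq_C hG
        simp
      · calc _ ≤ ∑ k, 3 ^ N * (fock F F * fock (pderiv k G) (pderiv k G)) :=
              Finset.sum_le_sum fun k _ => ih (by omega) hF hG.pderiv
          _ = _ := by
            rw [← Finset.mul_sum, ← Finset.mul_sum, sum_fock_pderiv hG]
            ring
    have key : ∀ k : σ,
        gaussE (wick (pderiv k F) * pderiv k (wick F * wick G ^ 2))
          + gaussE (wick (pderiv k G) * pderiv k (wick G * wick F ^ 2))
        ≤ 3 * (gaussE ((wick (pderiv k F) * wick G) ^ 2)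
          + gaussE ((wick F * wick (pderiv k G)) ^ 2)) := by
      intro k
      have h := gaussE_sq_nonneg (wick (pderiv k F) * wick G - wick F * wick (pderiv k G))
      set f := wick F
      set g := wick G
      have hf : pderiv k f = wick (pderiv k F) := pderiv_wick k F
      have hg : pderiv k g = wick (pderiv k G) := pderiv_wick k G
      rw [← hf, ← hg] at h ⊢
      have e1 : (pderiv k f * g - f * pderiv k g) ^ 2
          = (pderiv k f * g) ^ 2 + (f * pderiv k g) ^ 2
            - (2 : ℝ) • (pderiv k f * g * (f * pderiv k g)) := by
        simp only [smul_eq_C_mul, map_ofNat]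
        ring
      have e2 : pderiv k f * pderiv k (f * g ^ 2)
          = (pderiv k f * g) ^ 2 + (2 : ℝ) • (pderiv k f * g * (f * pderiv k g)) := by
        simp only [smul_eq_C_mul, map_ofNat, pderiv_mul, pderiv_pow]
        push_cast
        ring
      have e3 : pderiv k g * pderiv k (g * f ^ 2)
          = (f * pderiv k g) ^ 2 + (2 : ℝ) • (pderiv k f * g * (f * pderiv k g)) := by
        simp only [smul_eq_C_mul, map_ofNat, pderiv_mul, pderiv_pow]
        push_cast
        ring
      rw [e1] at h
      rw [e2, e3]
      simp only [map_add, map_sub, map_smul, smul_eq_mul] at h ⊢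
      linarith
    have hsum := Finset.sum_le_sum fun k (_ : k ∈ Finset.univ) => key k
    rw [Finset.sum_add_distrib, ← Finset.mul_sum, Finset.sum_add_distrib,
      sum_gaussE_wick_pderiv_mul hF, sum_gaussE_wick_pderiv_mul hG,
      show wick F * (wick F * wick G ^ 2) = (wick F * wick G) ^ 2 by ring,
      show wick G * (wick G * wick F ^ 2) = (wick F * wick G) ^ 2 by ring] at hsum
    have hN : (a : ℝ) + b = N + 1 := by exact_mod_cast hab
    have hpos : (0 : ℝ) < N + 1 := by positivity
    refine le_of_mul_le_mul_left ?_ hpos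
    rw [pow_succ (3 : ℝ) N, ← hN]
    linarith

end ChaosInequalities

section Bombieri

variable {σ : Type} [Fintype σ]

lemma sum_fock_mul_pderiv_mul {m : ℕ} {P : MvPolynomial σ ℝ} (hP : P.IsHomogeneous m)
    (S R : MvPolynomial σ ℝ) :
    ∑ k, fock (pderiv k R) (pderiv k P * S) = m * fock R (P * S) := by
  simp_rw [fock_comm _ (_ * S)]
  exact sum_fock_pderiv_mul hP S R

lemma succ_mul_sum_fock_mul_mul {ι : Type} [Fintype ι] {i : ℕ} {P Q : ι → MvPolynomial σ ℝ}
    (hP : ∀ s, (P s).IsHomogeneous (i + 1)) :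
    ((i : ℝ) + 1) * ∑ s, ∑ t, fock (P s * Q t) (P t * Q s)
      = ∑ k, ∑ s, ∑ t, fock (pderiv k (P s) * Q t) (pderiv k (P t) * Q s)
        + ∑ s, ∑ t, ∑ k, fock (pderiv k (P s) * Q t) (P t * pderiv k (Q s)) := by
  have e : ∀ s t, ((i : ℝ) + 1) * fock (P s * Q t) (P t * Q s)
      = ∑ k, fock (pderiv k (P s) * Q t) (pderiv k (P t) * Q s)
        + ∑ k, fock (pderiv k (P s) * Q t) (P t * pderiv k (Q s)) := by
    intro s t
    have h := sum_fock_pderiv_mul (hP s) (Q t) (P t * Q s)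
    push_cast at h
    rw [← h, ← Finset.sum_add_distrib]
    refine Finset.sum_congr rfl fun k _ => ?_
    rw [pderiv_mul, fock_add_right]
  simp_rw [Finset.mul_sum, e, Finset.sum_add_distrib]
  congr 1
  simp_rw [Finset.sum_comm (s := (Finset.univ : Finset ι)) (t := (Finset.univ : Finset σ))]

lemma succ_mul_sum_fock_pderiv_mul_mul {ι : Type} [Fintype ι] {i : ℕ}
    {P Q : ι → MvPolynomial σ ℝ} (hP : ∀ s, (P s).IsHomogeneous (i + 1)) :
    ((i : ℝ) + 1) * ∑ s, ∑ t, ∑ k, fock (pderiv k (P s) * Q t) (P t * pderiv k (Q s))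
      = ∑ l, ∑ s, ∑ t, ∑ k,
          fock (pderiv k (pderiv l (P s)) * Q t) (pderiv l (P t) * pderiv k (Q s))
        + ∑ s : ι × σ, ∑ t : ι × σ, fock (pderiv s.2 (P s.1) * pderiv t.2 (Q t.1))
          (pderiv t.2 (P t.1) * pderiv s.2 (Q s.1)) := by
  have e : ∀ s t k, ((i : ℝ) + 1) * fock (pderiv k (P s) * Q t) (P t * pderiv k (Q s))
      = ∑ l, fock (pderiv k (pderiv l (P s)) * Q t) (pderiv l (P t) * pderiv k (Q s))
        + ∑ l, fock (pderiv k (P s) * pderiv l (Q t)) (pderiv l (P t) * pderiv k (Q s)) := by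
    intro s t k
    have h := sum_fock_mul_pderiv_mul (hP t) (pderiv k (Q s)) (pderiv k (P s) * Q t)
    push_cast at h
    rw [← h, ← Finset.sum_add_distrib]
    refine Finset.sum_congr rfl fun l _ => ?_
    rw [pderiv_mul, fock_comm, fock_add_right, pderiv_comm' l k]
    simp only [fock_comm (pderiv l (P t) * _)]
  simp_rw [Finset.mul_sum, e, Finset.sum_add_distrib, Fintype.sum_prod_type]
  congr 1
  · symm
    exact Finset.sum_comm.trans (Finset.sum_congr rfl fun s _ =>
      Finset.sum_comm.trans (Finset.sum_congr rfl fun t _ => Finset.sum_comm))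
  · refine Finset.sum_congr rfl fun s _ => ?_
    rw [Finset.sum_comm]

/-- Lower bounds for sums of twisted inner products of products of homogeneous polynomials. -/
lemma sum_fock_mul_mul_ge (i : ℕ) : ∀ {ι : Type} [Fintype ι] (P Q : ι → MvPolynomial σ ℝ),
    (∀ s, (P s).IsHomogeneous i) →
    (∑ s, ∑ t, fock (P s) (P t) * fock (Q t) (Q s) ≤ ∑ s, ∑ t, fock (P s * Q t) (P t * Q s))
    ∧ (0 ≤ ∑ s, ∑ t, fock (P s * Q t) (P t * Q s))
    ∧ (0 ≤ ∑ s, ∑ t, ∑ k, fock (pderiv k (P s) * Q t) (P t * pderiv k (Q s))) := by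
  induction i with
  | zero =>
    intro ι _ P Q hP
    choose c hc using fun s => IsHomogeneous.exists_eq_C (hP s)
    obtain rfl : P = fun s => C (c s) := funext hc
    have e : ∑ s, ∑ t, fock (C (c s) * Q t) (C (c t) * Q s)
        = fock (∑ s, C (c s) * Q s) (∑ s, C (c s) * Q s) := by
      rw [fock, map_sum, Finset.sum_mul_sum, map_sum]
      simp_rw [map_sum]
      refine Finset.sum_congr rfl fun s _ => Finset.sum_congr rfl fun t _ => ?_
      rw [← fock, fock_C_mul_C_mul, fock_C_mul_C_mul, fock_comm (Q t)]
    refine ⟨le_of_eq ?_, ?_, ?_⟩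
    · simp_rw [fock_C_mul_C_mul, fock_C_C]
    · rw [e]
      exact fock_self_nonneg _
    · simp [fock]
  | succ i ih =>
    intro ι _ P Q hP
    have hi : (0 : ℝ) < (i : ℝ) + 1 := by positivity
    have h1 : 0 ≤ ∑ s, ∑ t, ∑ k, fock (pderiv k (P s) * Q t) (P t * pderiv k (Q s)) := by
      refine nonneg_of_mul_nonneg_right ?_ hi
      rw [succ_mul_sum_fock_pderiv_mul_mul hP]
      refine add_nonneg (Finset.sum_nonneg fun l _ => ?_) ?_
      · exact (ih (fun s => pderiv l (P s)) Q fun s => (hP s).pderiv).2.2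
      · exact (ih (fun s : ι × σ => pderiv s.2 (P s.1)) (fun s => pderiv s.2 (Q s.1))
          fun s => (hP s.1).pderiv).2.1
    have h0 := succ_mul_sum_fock_mul_mul (Q := Q) hP
    refine ⟨?_, ?_, h1⟩
    · refine le_of_mul_le_mul_left ?_ hi
      rw [h0]
      refine le_add_of_le_of_nonneg ?_ h1
      calc _ = ∑ k, ∑ s, ∑ t, fock (pderiv k (P s)) (pderiv k (P t)) * fock (Q t) (Q s) := by
            rw [Finset.mul_sum, Finset.sum_comm]
            refine Finset.sum_congr rfl fun s _ => ?_
            rw [Finset.mul_sum, Finset.sum_comm]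
            refine Finset.sum_congr rfl fun t _ => ?_
            have h := sum_fock_pderiv (hP s) (P t)
            push_cast at h
            rw [← Finset.sum_mul, h, mul_assoc]
        _ ≤ _ := Finset.sum_le_sum fun k _ =>
            (ih (fun s => pderiv k (P s)) Q fun s => (hP s).pderiv).1
    · refine nonneg_of_mul_nonneg_right ?_ hi
      rw [h0]
      exact add_nonneg (Finset.sum_nonneg fun k _ =>
        (ih (fun s => pderiv k (P s)) Q fun s => (hP s).pderiv).2.1) h1

/-- Bombieri's inequality. -/
lemma fock_self_mul_fock_self_le {i : ℕ} {P : MvPolynomial σ ℝ} (hP : P.IsHomogeneous i)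
    (Q : MvPolynomial σ ℝ) : fock P P * fock Q Q ≤ fock (P * Q) (P * Q) := by
  simpa using (sum_fock_mul_mul_ge i (fun _ : Unit => P) (fun _ => Q) fun _ => hP).1

end Bombieri

section ChaosDecomposition

variable {σ : Type} [Fintype σ]

/-- The component of `wick F * wick G` in a Wiener chaos of order at least `a + b`. -/
lemma gaussE_wick_mul_wick_mul_wick (m : ℕ) : ∀ {a b : ℕ} {F G H : MvPolynomial σ ℝ},
    F.IsHomogeneous a → G.IsHomogeneous b → H.IsHomogeneous m → a + b ≤ m →
    gaussE (wick F * wick G * wick H) = fock (F * G) H := by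
  induction m with
  | zero =>
    intro a b F G H hF hG hH hab
    obtain ⟨rfl, rfl⟩ : a = 0 ∧ b = 0 := by omega
    obtain ⟨x, rfl⟩ := IsHomogeneous.exists_eq_C hF
    obtain ⟨y, rfl⟩ := IsHomogeneous.exists_eq_C hG
    rw [fock, ← C_mul, wick_C, wick_C, wick_C, C_mul]
  | succ m ih =>
    intro a b F G H hF hG hH hab
    have hm : ((m : ℝ) + 1) ≠ 0 := by positivity
    refine mul_left_cancel₀ hm ?_
    have h1 := sum_gaussE_wick_pderiv_mul hH (wick F * wick G)
    have h2 := sum_fock_pderiv hH (F * G)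
    push_cast at h1 h2
    rw [mul_comm (wick F * wick G), fock_comm, ← h1, ← h2]
    refine Finset.sum_congr rfl fun k _ => ?_
    rw [pderiv_mul, pderiv_mul, pderiv_wick, pderiv_wick, fock_add_right, mul_add, map_add]
    congr 1
    · rcases Nat.eq_zero_or_pos a with rfl | ha
      · obtain ⟨x, rfl⟩ := IsHomogeneous.exists_eq_C hF
        simp [fock]
      · rw [mul_comm, ih hF.pderiv hG hH.pderiv (by omega), fock_comm]
    · rcases Nat.eq_zero_or_pos b with rfl | hb
      · obtain ⟨x, rfl⟩ := IsHomogeneous.exists_eq_C hG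
        simp [fock]
      · rw [mul_comm, ih hF hG.pderiv hH.pderiv (by omega), fock_comm]

lemma gaussE_wick_eq_zero {m : ℕ} (hm : m ≠ 0) {H : MvPolynomial σ ℝ} (hH : H.IsHomogeneous m) :
    gaussE (wick H) = 0 := by
  have h := fock_eq_zero hm hH (isHomogeneous_C σ (1 : ℝ))
  rwa [fock, wick_C, C_1, mul_one] at h

lemma gVar_eq (p : MvPolynomial σ ℝ) : gVar p = gaussE (p ^ 2) - gaussE p ^ 2 := by
  simp only [gVar, gaussE_apply, map_pow, gExp]

lemma gaussE_sub_C_sq (p : MvPolynomial σ ℝ) : gaussE ((p - C (gaussE p)) ^ 2) = gVar p := by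
  have e : (p - C (gaussE p)) ^ 2
      = p ^ 2 - (2 * gaussE p) • p + C (gaussE p ^ 2) := by
    simp only [smul_eq_C_mul, C_mul, map_ofNat, C_pow]
    ring
  rw [e, map_add, map_sub, map_smul, gaussE_C, gVar_eq, smul_eq_mul]
  linarith

/-- Elements of a chaos of positive order only see the centred part of a polynomial. -/
lemma gaussE_mul_wick_le {m : ℕ} (hm : m ≠ 0) {H : MvPolynomial σ ℝ} (hH : H.IsHomogeneous m)
    (h : MvPolynomial σ ℝ) : gaussE (h * wick H) ≤ √(gVar h) * gNorm (wick H) := by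
  have e : gaussE (h * wick H) = gaussE ((h - C (gaussE h)) * wick H) := by
    rw [sub_mul, map_sub, ← smul_eq_C_mul, map_smul, gaussE_wick_eq_zero hm hH, smul_zero, sub_zero]
  rw [e, ← gaussE_sub_C_sq]
  exact gaussE_mul_le _ _

variable {F G : ℕ → MvPolynomial σ ℝ}

lemma gNorm_wick_sum_sq (hF : ∀ a, (F a).IsHomogeneous a) (s : Finset ℕ) :
    gNorm (wick (∑ a ∈ s, F a)) ^ 2 = ∑ a ∈ s, gNorm (wick (F a)) ^ 2 := by
  simp_rw [← fock_self]
  rw [fock, map_sum, Finset.sum_mul_sum, map_sum]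
  refine Finset.sum_congr rfl fun a ha => ?_
  rw [map_sum]
  refine Finset.sum_eq_single_of_mem a ha fun b _ hb => ?_
  exact fock_eq_zero hb.symm (hF a) (hF b)

lemma gNorm_wick_sum_mono (hF : ∀ a, (F a).IsHomogeneous a) {s t : Finset ℕ} (hst : s ⊆ t) :
    gNorm (wick (∑ a ∈ s, F a)) ≤ gNorm (wick (∑ a ∈ t, F a)) := by
  refine (abs_le_of_sq_le_sq' ?_ (gNorm_nonneg _)).2
  rw [gNorm_wick_sum_sq hF, gNorm_wick_sum_sq hF]
  exact Finset.sum_le_sum_of_subset_of_nonneg hst fun _ _ _ => sq_nonneg _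

lemma gVar_wick_sum (hF : ∀ a, (F a).IsHomogeneous a) (d : ℕ) :
    gVar (wick (∑ a ∈ Finset.range (d + 1), F a))
      = gNorm (wick (∑ a ∈ Finset.Ioc 0 d, F a)) ^ 2 := by
  have hs : Finset.range (d + 1) = insert 0 (Finset.Ioc 0 d) := by
    ext x
    simp only [Finset.mem_range, Finset.mem_insert, Finset.mem_Ioc]
    omega
  have h0 : (0 : ℕ) ∉ Finset.Ioc 0 d := by simp
  obtain ⟨c, hc⟩ := IsHomogeneous.exists_eq_C (hF 0)
  have hE : gaussE (wick (∑ a ∈ Finset.range (d + 1), F a)) = c := by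
    rw [hs, Finset.sum_insert h0, map_add, map_add, map_sum, map_sum, hc, wick_C, gaussE_C,
      Finset.sum_eq_zero, add_zero]
    intro a ha
    exact gaussE_wick_eq_zero (by simp at ha; omega) (hF a)
  rw [gVar_eq, hE, ← gNorm_sq, gNorm_wick_sum_sq hF, gNorm_wick_sum_sq hF, hs,
    Finset.sum_insert h0, hc, wick_C, gNorm_sq, ← C_pow, gaussE_C]
  ring

/-- Chaos decomposition of a polynomial. -/
lemma exists_eq_wick_sum {d : ℕ} {p : MvPolynomial σ ℝ} (hp : p.totalDegree ≤ d) :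
    ∃ F : ℕ → MvPolynomial σ ℝ, (∀ a, (F a).IsHomogeneous a) ∧
      p = wick (∑ a ∈ Finset.range (d + 1), F a) := by
  obtain ⟨P, hP, rfl⟩ := exists_wick_eq hp
  refine ⟨fun a => homogeneousComponent a P, fun a => homogeneousComponent_isHomogeneous a P, ?_⟩
  congr 1
  conv_lhs => rw [← sum_homogeneousComponent P]
  refine Finset.sum_subset (Finset.range_mono (by omega)) fun a _ ha => ?_
  exact homogeneousComponent_eq_zero _ _ (by simpa using ha)

lemma gNorm_wick_mul_wick_le {a b d : ℕ} {F G : MvPolynomial σ ℝ} (hF : F.IsHomogeneous a)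
    (hG : G.IsHomogeneous b) (ha : a ≤ d) (hb : b ≤ d) :
    gNorm (wick F * wick G) ≤ 3 ^ d * (gNorm (wick F) * gNorm (wick G)) := by
  have h0 := mul_nonneg (gNorm_nonneg (wick F)) (gNorm_nonneg (wick G))
  refine (abs_le_of_sq_le_sq' ?_ (by positivity)).2
  rw [gNorm_sq, mul_pow (3 ^ d : ℝ), mul_pow (gNorm _), ← fock_self, ← fock_self, ← pow_mul]
  refine (gaussE_wick_mul_wick_sq_le _ rfl hF hG).trans ?_
  have := mul_nonneg (fock_self_nonneg F) (fock_self_nonneg G)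
  gcongr
  · norm_num
  · omega

/-- The `L²(γ)` norm of a product of polynomials of degree at most `d`. -/
lemma gNorm_wick_sum_mul_le (hF : ∀ a, (F a).IsHomogeneous a) (hG : ∀ a, (G a).IsHomogeneous a)
    {d : ℕ} {s t : Finset ℕ} (hs : s ⊆ Finset.range (d + 1)) (ht : t ⊆ Finset.range (d + 1)) :
    gNorm (wick (∑ a ∈ s, F a) * wick (∑ b ∈ t, G b))
      ≤ 3 ^ d * (d + 1) ^ 2 * (gNorm (wick (∑ a ∈ s, F a)) * gNorm (wick (∑ b ∈ t, G b))) := by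
  set x := gNorm (wick (∑ a ∈ s, F a)) with hx
  set y := gNorm (wick (∑ b ∈ t, G b)) with hy
  have hx0 : 0 ≤ x := gNorm_nonneg _
  have hy0 : 0 ≤ y := gNorm_nonneg _
  have hle : ∀ {s : Finset ℕ}, s ⊆ Finset.range (d + 1) → (s.card : ℝ) ≤ d + 1 := by
    intro s hs
    have := Finset.card_le_card hs
    rw [Finset.card_range] at this
    exact_mod_cast this
  have hterm : ∀ a ∈ s, ∀ b ∈ t, gNorm (wick (F a) * wick (G b)) ≤ 3 ^ d * (x * y) := by
    intro a ha b hb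
    have h1 := gNorm_wick_sum_mono hF (Finset.singleton_subset_iff.2 ha)
    have h2 := gNorm_wick_sum_mono hG (Finset.singleton_subset_iff.2 hb)
    rw [Finset.sum_singleton] at h1 h2
    refine (gNorm_wick_mul_wick_le (hF a) (hG b) (Nat.lt_succ_iff.1 (Finset.mem_range.1 (hs ha)))
      (Nat.lt_succ_iff.1 (Finset.mem_range.1 (ht hb)))).trans ?_
    have := mul_le_mul h1 h2 (gNorm_nonneg _) hx0
    gcongr
  calc gNorm (wick (∑ a ∈ s, F a) * wick (∑ b ∈ t, G b))
      = gNorm (∑ a ∈ s, ∑ b ∈ t, wick (F a) * wick (G b)) := by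
        rw [map_sum, map_sum, Finset.sum_mul_sum]
    _ ≤ ∑ a ∈ s, ∑ b ∈ t, gNorm (wick (F a) * wick (G b)) :=
        (gNorm_sum_le _ _).trans (Finset.sum_le_sum fun a _ => gNorm_sum_le _ _)
    _ ≤ ∑ a ∈ s, ∑ b ∈ t, 3 ^ d * (x * y) :=
        Finset.sum_le_sum fun a ha => Finset.sum_le_sum fun b hb => hterm a ha b hb
    _ = (s.card * t.card) * (3 ^ d * (x * y)) := by
        simp only [Finset.sum_const, nsmul_eq_mul]
        ring
    _ ≤ ((d + 1) * (d + 1)) * (3 ^ d * (x * y)) := by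
        gcongr
        · exact hle hs
        · exact hle ht
    _ = _ := by ring

/-- The variance of a product is bounded below through the product of the `i`-th and `j`-th
chaos components, up to the tails beyond these components. -/
lemma gNorm_mul_gNorm_le_sqrt_gVar (hF : ∀ a, (F a).IsHomogeneous a)
    (hG : ∀ a, (G a).IsHomogeneous a) {d i j : ℕ} (hi : i ≤ d) (hj : j ≤ d) (hij : i + j ≠ 0)
    {M : ℝ} (hMF : 3 ^ d * (d + 1) ^ 2 * gNorm (wick (∑ a ∈ Finset.range (d + 1), F a)) ≤ M)
    (hMG : 3 ^ d * (d + 1) ^ 2 * gNorm (wick (∑ a ∈ Finset.range (d + 1), G a)) ≤ M) :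
    gNorm (wick (F i)) * gNorm (wick (G j))
      ≤ √(gVar (wick (∑ a ∈ Finset.range (d + 1), F a) * wick (∑ a ∈ Finset.range (d + 1), G a)))
        + M * (gNorm (wick (∑ a ∈ Finset.Ioc i d, F a))
          + gNorm (wick (∑ a ∈ Finset.Ioc j d, G a))) := by
  have hsplit : ∀ (E : ℕ → MvPolynomial σ ℝ) {i : ℕ}, i ≤ d →
      ∑ a ∈ Finset.range (d + 1), E a
        = ∑ a ∈ Finset.range (i + 1), E a + ∑ a ∈ Finset.Ioc i d, E a := by
    intro E i hi
    rw [← Finset.sum_union]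
    · congr 1
      ext x
      simp only [Finset.mem_range, Finset.mem_union, Finset.mem_Ioc]
      omega
    · rw [Finset.disjoint_left]
      simp only [Finset.mem_range, Finset.mem_Ioc]
      omega
  have hIoc : ∀ i, Finset.Ioc i d ⊆ Finset.range (d + 1) := by
    intro i x
    simp only [Finset.mem_range, Finset.mem_Ioc]
    omega
  have hrange : ∀ {i : ℕ}, i ≤ d → Finset.range (i + 1) ⊆ Finset.range (d + 1) :=
    fun h => Finset.range_mono (by omega)
  set H := F i * G j with hH
  have hHh : H.IsHomogeneous (i + j) := (hF i).mul (hG j)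
  set W := √(gVar (wick (∑ a ∈ Finset.range (d + 1), F a)
    * wick (∑ a ∈ Finset.range (d + 1), G a)))
  set u := gNorm (wick (∑ a ∈ Finset.Ioc i d, F a)) with hu
  set v := gNorm (wick (∑ a ∈ Finset.Ioc j d, G a)) with hv
  have hu0 : 0 ≤ u := gNorm_nonneg _
  have hv0 : 0 ≤ v := gNorm_nonneg _
  have hN0 := gNorm_nonneg (wick H)
  have hmain : gaussE (wick (∑ a ∈ Finset.range (i + 1), F a)
      * wick (∑ b ∈ Finset.range (j + 1), G b) * wick H) = gNorm (wick H) ^ 2 := by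
    rw [map_sum, map_sum, Finset.sum_mul_sum, Finset.sum_mul, map_sum, ← fock_self]
    simp_rw [Finset.sum_mul, map_sum]
    rw [Finset.sum_eq_single_of_mem i (by simp), Finset.sum_eq_single_of_mem j (by simp)]
    · exact gaussE_wick_mul_wick_mul_wick _ (hF i) (hG j) hHh le_rfl
    · intro b hb hbj
      have := Finset.mem_range.1 hb
      rw [gaussE_wick_mul_wick_mul_wick _ (hF i) (hG b) hHh (by omega)]
      exact fock_eq_zero (by omega) ((hF i).mul (hG b)) hHh
    · intro a ha hai
      refine Finset.sum_eq_zero fun b hb => ?_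
      have := Finset.mem_range.1 ha
      have := Finset.mem_range.1 hb
      rw [gaussE_wick_mul_wick_mul_wick _ (hF a) (hG b) hHh (by omega)]
      exact fock_eq_zero (by omega) ((hF a).mul (hG b)) hHh
  have hdec : wick (∑ a ∈ Finset.range (i + 1), F a) * wick (∑ b ∈ Finset.range (j + 1), G b)
      = wick (∑ a ∈ Finset.range (d + 1), F a) * wick (∑ b ∈ Finset.range (d + 1), G b)
        - wick (∑ a ∈ Finset.Ioc i d, F a) * wick (∑ b ∈ Finset.range (d + 1), G b)
        - wick (∑ a ∈ Finset.range (i + 1), F a) * wick (∑ b ∈ Finset.Ioc j d, G b) := by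
    rw [hsplit F hi, hsplit G hj, map_add, map_add]
    ring
  have hneg : ∀ f : MvPolynomial σ ℝ, -gaussE (f * wick H) ≤ gNorm f * gNorm (wick H) := by
    intro f
    have h := gaussE_mul_le (-f) (wick H)
    rwa [neg_mul, map_neg, gNorm, neg_sq, ← gNorm] at h
  have hK : (0 : ℝ) ≤ 3 ^ d * (d + 1) ^ 2 := by positivity
  have h1 : gNorm (wick (∑ a ∈ Finset.Ioc i d, F a) * wick (∑ b ∈ Finset.range (d + 1), G b))
      ≤ M * u := by
    refine (gNorm_wick_sum_mul_le hF hG (hIoc i) subset_rfl).trans ?_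
    rw [← hu, mul_comm u, ← mul_assoc]
    gcongr
  have h2 : gNorm (wick (∑ a ∈ Finset.range (i + 1), F a) * wick (∑ b ∈ Finset.Ioc j d, G b))
      ≤ M * v := by
    refine (gNorm_wick_sum_mul_le hF hG (hrange hi) (hIoc j)).trans ?_
    rw [← hv, ← mul_assoc]
    gcongr
    refine le_trans ?_ hMF
    gcongr
    exact gNorm_wick_sum_mono hF (hrange hi)
  have hsq : gNorm (wick H) ^ 2 ≤ (W + M * (u + v)) * gNorm (wick H) := by
    rw [← hmain, hdec, sub_mul, sub_mul, map_sub, map_sub, mul_add, add_mul, add_mul, ← add_assoc,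
      sub_eq_add_neg, sub_eq_add_neg]
    exact add_le_add (add_le_add (gaussE_mul_wick_le hij hHh _)
      ((hneg _).trans (mul_le_mul_of_nonneg_right h1 hN0)))
      ((hneg _).trans (mul_le_mul_of_nonneg_right h2 hN0))
  have hle : gNorm (wick (F i)) * gNorm (wick (G j)) ≤ gNorm (wick H) := by
    refine (abs_le_of_sq_le_sq' ?_ hN0).2
    rw [mul_pow, ← fock_self, ← fock_self, ← fock_self]
    exact fock_self_mul_fock_self_le (hF i) (G j)
  refine hle.trans ?_
  have hM : 0 ≤ M := le_trans (mul_nonneg hK (gNorm_nonneg _)) hMF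
  have hW : 0 ≤ W := Real.sqrt_nonneg _
  rcases hN0.eq_or_lt with h0 | h0
  · rw [← h0]
    exact add_nonneg hW (mul_nonneg hM (add_nonneg hu0 hv0))
  · rw [sq] at hsq
    exact le_of_mul_le_mul_right hsq h0

end ChaosDecomposition

section TailRecursion

lemma sq_recursion_lower_bound {d : ℕ} {U V u v : ℕ → ℝ} {W M L : ℝ}
    (hU0 : U 0 = 1) (hV0 : V 0 = 1) (hUd : U d = 0) (hVd : V d = 0)
    (hu : ∀ i, 0 ≤ u i) (hv : ∀ i, 0 ≤ v i) (hU : ∀ i, 0 ≤ U i) (hV : ∀ i, 0 ≤ V i)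
    (hUu : ∀ i < d, U i ≤ U (i + 1) + u (i + 1)) (hVv : ∀ i < d, V i ≤ V (i + 1) + v (i + 1))
    (hM : 1 ≤ M) (hL : 8 * M < L)
    (huv : ∀ i ≤ d, ∀ j ≤ d, i + j ≠ 0 → u i * v j ≤ W + M * (U i + V j)) :
    L / 2 * L⁻¹ ^ 2 ^ (2 * d) ≤ W := by
  by_contra! hW
  have hd : d ≠ 0 := by
    rintro rfl
    linarith
  have hLpos : 0 < L := by linarith
  set x := L⁻¹ with hx
  have hx0 : 0 < x := inv_pos.2 hLpos
  have hLx : L * x = 1 := mul_inv_cancel₀ hLpos.ne'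
  have hx1 : x ≤ 1 := inv_le_one_of_one_le₀ (by linarith)
  have hMx : 8 * M * x < 1 := by
    rw [← hLx]
    exact mul_lt_mul_of_pos_right hL hx0
  have hpow : ∀ m : ℕ, x ^ 2 ^ m ≤ x := fun m =>
    pow_le_of_le_one hx0.le hx1 (by positivity)
  set δ : ℕ → ℝ := fun s => 8 * M * x ^ 2 ^ (2 * d - 1 - s) with hδ
  have hδ0 : ∀ s, 0 < δ s := fun s => by positivity
  have hδ1 : ∀ s, δ s < 1 := fun s => by
    refine lt_of_le_of_lt ?_ hMx
    exact mul_le_mul_of_nonneg_left (hpow _) (by positivity)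
  have hδsq : ∀ s, s + 1 ≤ 2 * d - 1 → δ (s + 1) ^ 2 = 8 * M * δ s := by
    intro s hs
    have e : 2 * d - 1 - s = (2 * d - 1 - (s + 1)) + 1 := by omega
    simp only [hδ]
    rw [e, pow_succ 2, pow_mul]
    ring
  have key : ∀ s, s ≤ 2 * d - 1 → W ≤ M * δ s ∧
      ∃ i ≤ d, ∃ j ≤ d, i + j + s = 2 * d ∧ U i ≤ δ s ∧ V j ≤ δ s := by
    intro s
    induction s with
    | zero =>
      intro _
      refine ⟨?_, d, le_rfl, d, le_rfl, by omega, ?_, ?_⟩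
      · have e : 2 * d = (2 * d - 1) + 1 := by omega
        rw [e, pow_succ 2, pow_mul] at hW
        have hy := hpow (2 * d - 1)
        simp only [hδ, Nat.sub_zero]
        set y := x ^ 2 ^ (2 * d - 1)
        have hy0 : 0 < y := by positivity
        have h1 : L * (y * y) ≤ y := by
          calc L * (y * y) ≤ L * (x * y) := by gcongr
            _ = y := by rw [← mul_assoc, hLx, one_mul]
        have h2 : y ≤ M * M * y := le_mul_of_one_le_left hy0.le (by nlinarith)
        nlinarith
      · rw [hUd]
        exact (hδ0 0).le
      · rw [hVd]
        exact (hδ0 0).le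
    | succ s ih =>
      intro hs
      obtain ⟨hWs, i, hi, j, hj, hijs, hUi, hVj⟩ := ih (by omega)
      have hsq := hδsq s hs
      have h0 := hδ0 s
      have h1 := hδ1 s
      have h0' := hδ0 (s + 1)
      have hmono : δ s ≤ δ (s + 1) := by
        refine (abs_le_of_sq_le_sq' ?_ h0'.le).2
        rw [hsq]
        nlinarith
      have hi0 : i ≠ 0 := by
        rintro rfl
        linarith
      have hj0 : j ≠ 0 := by
        rintro rfl
        linarith
      have hM0 : 0 < M := by linarith
      have hprod : u i * v j ≤ 3 * (M * δ s) := by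
        have h := huv i hi j hj (by omega)
        have : M * (U i + V j) ≤ M * (δ s + δ s) := by gcongr
        linarith
      have hstep : ∀ a b : ℝ, 0 ≤ a → 0 ≤ b → a ≤ δ s → b ^ 2 ≤ 3 * (M * δ s) →
          a + b ≤ δ (s + 1) := by
        intro a b ha hb haδ hb2
        refine (abs_le_of_sq_le_sq' ?_ h0'.le).2
        rw [hsq]
        have h3 : a ^ 2 ≤ M * δ s := by nlinarith
        nlinarith [sq_nonneg (a - b)]
      refine ⟨hWs.trans (by gcongr), ?_⟩
      rcases le_total (u i) (v j) with h | h
      · obtain ⟨k, rfl⟩ := Nat.exists_eq_succ_of_ne_zero hi0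
        refine ⟨k, by omega, j, hj, by omega, ?_, hVj.trans hmono⟩
        refine (hUu k hi).trans (hstep _ _ (hU _) (hu _) hUi ?_)
        rw [sq]
        exact (mul_le_mul_of_nonneg_left h (hu _)).trans hprod
      · obtain ⟨k, rfl⟩ := Nat.exists_eq_succ_of_ne_zero hj0
        refine ⟨i, hi, k, by omega, by omega, hUi.trans hmono, ?_⟩
        refine (hVv k hj).trans (hstep _ _ (hV _) (hv _) hVj ?_)
        rw [sq]
        exact (mul_le_mul_of_nonneg_right h (hv _)).trans hprod
  obtain ⟨-, i, -, j, -, hij, hUi, hVj⟩ := key (2 * d - 1) le_rfl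
  have h1 := hδ1 (2 * d - 1)
  have : i = 0 ∨ j = 0 := by omega
  rcases this with rfl | rfl <;> linarith

end TailRecursion

lemma gNorm_wick_tail_le {σ : Type} [Fintype σ] (F : ℕ → MvPolynomial σ ℝ) {i d : ℕ}
    (hi : i < d) :
    gNorm (wick (∑ a ∈ Finset.Ioc i d, F a))
      ≤ gNorm (wick (∑ a ∈ Finset.Ioc (i + 1) d, F a)) + gNorm (wick (F (i + 1))) := by
  have hs : Finset.Ioc i d = insert (i + 1) (Finset.Ioc (i + 1) d) := by
    ext x
    simp only [Finset.mem_insert, Finset.mem_Ioc]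
    omega
  rw [hs, Finset.sum_insert (by simp), map_add, add_comm (gNorm _)]
  exact gNorm_add_le _ _

/-- For degree-`d` polynomials `p, q` with `Var p = Var q = 1`,
with `T = max(E[p²], E[q²])` and `L = 4 T 9^{d+1} (d+1)²`,
`√(Var(p·q)) ≥ (L/2) · L^{-2^{2d}}`. -/
theorem stmt17 {n d : ℕ} (p q : MvPolynomial (Fin n) ℝ)
    (hp : p.totalDegree ≤ d) (hq : q.totalDegree ≤ d)
    (hvp : gVar p = 1) (hvq : gVar q = 1)
    (T L : ℝ)
    (hT : T = max (∫ x, (eval x p) ^ 2 ∂gaussianPi (Fin n))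
        (∫ x, (eval x q) ^ 2 ∂gaussianPi (Fin n)))
    (hL : L = 4 * T * 9 ^ (d + 1) * (d + 1) ^ 2) :
    Real.sqrt (gVar (p * q)) ≥ (L / 2) * L ^ (-(2 : ℝ) ^ (2 * d)) := by
  have hT' : T = max (gaussE (p ^ 2)) (gaussE (q ^ 2)) := by
    simp only [hT, gaussE_apply, map_pow]
  have hpT : gaussE (p ^ 2) ≤ T := hT' ▸ le_max_left _ _
  have hqT : gaussE (q ^ 2) ≤ T := hT' ▸ le_max_right _ _
  have hT1 : 1 ≤ T := by
    rw [gVar_eq] at hvp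
    nlinarith [sq_nonneg (gaussE p)]
  have hsqrtT : √T ≤ T := Real.sqrt_le_iff.2 ⟨by linarith, by nlinarith⟩
  have hsqrtT1 : 1 ≤ √T := Real.one_le_sqrt.2 hT1
  have hd1 : (1 : ℝ) ≤ (d + 1) ^ 2 := one_le_pow₀ (by linarith [Nat.cast_nonneg (α := ℝ) d])
  have h3 : (1 : ℝ) ≤ 3 ^ d := one_le_pow₀ (by norm_num)
  have h39 : (3 : ℝ) ^ d ≤ 9 ^ d := pow_le_pow_left₀ (by norm_num) (by norm_num) d
  have hK : (1 : ℝ) ≤ 3 ^ d * (d + 1) ^ 2 := one_le_mul_of_one_le_of_one_le h3 hd1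
  have hM : 1 ≤ 3 ^ d * (d + 1) ^ 2 * √T := one_le_mul_of_one_le_of_one_le hK hsqrtT1
  have hML : 8 * (3 ^ d * (d + 1) ^ 2 * √T) < L := by
    have h : 3 ^ d * (d + 1) ^ 2 * √T ≤ 9 ^ d * (d + 1) ^ 2 * T := by gcongr
    have hL' : L = 36 * (9 ^ d * (d + 1) ^ 2 * T) := by
      rw [hL, pow_succ]
      ring
    linarith
  have hL0 : 0 ≤ L := by linarith
  have hexp : L ^ (-(2 : ℝ) ^ (2 * d)) = L⁻¹ ^ 2 ^ (2 * d) := by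
    have e : (2 : ℝ) ^ (2 * d) = ((2 ^ (2 * d) : ℕ) : ℝ) := by push_cast; rfl
    rw [Real.rpow_neg hL0, e, Real.rpow_natCast, inv_pow]
  rw [ge_iff_le, hexp]
  obtain ⟨F, hF, rfl⟩ := exists_eq_wick_sum hp
  obtain ⟨G, hG, rfl⟩ := exists_eq_wick_sum hq
  rw [gVar_wick_sum hF, pow_eq_one_iff_of_nonneg (gNorm_nonneg _) two_ne_zero] at hvp
  rw [gVar_wick_sum hG, pow_eq_one_iff_of_nonneg (gNorm_nonneg _) two_ne_zero] at hvq
  refine sq_recursion_lower_bound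
    (U := fun i => gNorm (wick (∑ a ∈ Finset.Ioc i d, F a)))
    (V := fun i => gNorm (wick (∑ a ∈ Finset.Ioc i d, G a)))
    (u := fun i => gNorm (wick (F i))) (v := fun i => gNorm (wick (G i)))
    hvp hvq (by simp [gNorm_zero]) (by simp [gNorm_zero])
    (fun _ => gNorm_nonneg _) (fun _ => gNorm_nonneg _) (fun _ => gNorm_nonneg _)
    (fun _ => gNorm_nonneg _) (fun _ => gNorm_wick_tail_le F) (fun _ => gNorm_wick_tail_le G)
    hM hML fun i hi j hj hij => ?_
  refine gNorm_mul_gNorm_le_sqrt_gVar hF hG hi hj hij ?_ ?_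
  · exact mul_le_mul_of_nonneg_left (Real.sqrt_le_sqrt hpT) (by positivity)
  · exact mul_le_mul_of_nonneg_left (Real.sqrt_le_sqrt hqT) (by positivity)
end
end
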